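/- arXiv:2604.28172 — 2 statements merged into one kernel-verified Lean document; each statement's English description precedes it below -/
import Mathlib

section
/- For every constant α > 0 there is a constant c > 0 such that for all integers D, k, n with D ≤ 2 log n and k = ⌈αD⌉: if G ~ G(n,k,n^{−2/D}), then with probability tending to 1 as n → ∞, every tree-like semantic Th(⌊log n / (2 log log n)⌋) refutation of the binary block clique formula bclique_b(G,k) has length at least n^{c·D}. -/
open Finset

abbrev Vtx (k n : ℕ) := Fin k × Fin n
abbrev Tup (k n : ℕ) := Fin k → Fin n

/-- Potential edges: pairs of vertices lying in distinct blocks. -/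
def potEdges (k n : ℕ) : Finset (Sym2 (Vtx k n)) :=
  Finset.univ.filter fun e => ¬ (Sym2.map Prod.fst e).IsDiag

open Classical in
/-- The probability, under the distribution `G(n,k,p)` (each potential edge present
independently with probability `p`), that the sampled graph satisfies `P`. -/
noncomputable def probG (k n : ℕ) (p : ℝ) (P : Finset (Sym2 (Vtx k n)) → Prop) : ℝ :=
  ∑ G ∈ (potEdges k n).powerset,
    if P G then p ^ G.card * (1 - p) ^ ((potEdges k n).card - G.card) else 0

/-- The biased character `χ_E(G) = ∏_{e ∈ E} χ_e(G)`. -/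
noncomputable def chiE {k n : ℕ} (p : ℝ) (G E : Finset (Sym2 (Vtx k n))) : ℝ :=
  ∏ e ∈ E, if e ∈ G then (1 - p) / p else -1

/-- The edge of a tuple `t` joining its vertices in blocks `i` and `j`. -/
def tupEdge {k n : ℕ} (t : Tup k n) (i j : Fin k) : Sym2 (Vtx k n) := s((i, t i), (j, t j))

/-- `t` is a `k`-clique of `G`. -/
def IsClique {k n : ℕ} (G : Finset (Sym2 (Vtx k n))) (t : Tup k n) : Prop :=
  ∀ i j : Fin k, i ≠ j → tupEdge t i j ∈ G

/-- `S` is a vertex cover of the graph `H` on `[k]`. -/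
def IsCover {k : ℕ} (H : Finset (Sym2 (Fin k))) (S : Finset (Fin k)) : Prop :=
  ∀ e ∈ H, ∃ v ∈ S, v ∈ e

/-- Minimum vertex cover size. -/
noncomputable def vc {k : ℕ} (H : Finset (Sym2 (Fin k))) : ℕ :=
  sInf {m | ∃ S : Finset (Fin k), S.card = m ∧ IsCover H S}

/-- The graph `H(t)` on the vertices of the tuple `t` obtained from a graph `H` on `[k]`. -/
def graphOf {k n : ℕ} (H : Finset (Sym2 (Fin k))) (t : Tup k n) : Finset (Sym2 (Vtx k n)) :=
  H.image (Sym2.map fun i => (i, t i))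

open Classical in
/-- The pseudo-measure `μ_{G,d}` on a single tuple. -/
noncomputable def mu {k n : ℕ} (p : ℝ) (G : Finset (Sym2 (Vtx k n))) (d : ℝ) (t : Tup k n) : ℝ :=
  ((n : ℝ) ^ k)⁻¹ *
    ∑ H ∈ Finset.univ.filter
        (fun H : Finset (Sym2 (Fin k)) => (∀ e ∈ H, ¬ e.IsDiag) ∧ (vc H : ℝ) ≤ d),
      chiE p G (graphOf H t)

/-- The pseudo-measure `μ_{G,d}` on a set of tuples. -/
noncomputable def muSet {k n : ℕ} (p : ℝ) (G : Finset (Sym2 (Vtx k n))) (d : ℝ)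
    (Q : Finset (Tup k n)) : ℝ :=
  ∑ t ∈ Q, mu p G d t

/-- `Q` is ruled out by a missing edge: some potential edge `e ∉ E(G)` satisfies `e ⊆ t`
for every `t ∈ Q`. -/
def RuledOut {k n : ℕ} (G : Finset (Sym2 (Vtx k n))) (Q : Finset (Tup k n)) : Prop :=
  ∃ e ∈ potEdges k n, e ∉ G ∧ ∀ t ∈ Q, ∀ u ∈ e, t u.1 = u.2


/-- A Boolean function on `N` variables, viewed as the indicator of the set of
assignments it rules out. -/
abbrev BFunc (N : ℕ) := (Fin N → Bool) → Bool

/-- A clause over `N` Boolean variables: a disjunction of literals over distinct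
variables, recorded by the polarity (if any) of each variable. -/
abbrev Clause (N : ℕ) := Fin N → Option Bool

/-- The assignment `α` satisfies the clause `c`. -/
def clauseSat {N : ℕ} (c : Clause N) (α : Fin N → Bool) : Prop :=
  ∃ i b, c i = some b ∧ α i = b

/-- The indicator of the falsifying assignments of the clause `c`. -/
def falsInd {N : ℕ} (c : Clause N) : BFunc N :=
  fun α => decide (∀ i b, c i = some b → α i ≠ b)

/-- A tree-like semantic proof: a tree each of whose nodes is labelled with a Boolean
function and has at most two children. -/
inductive SemProof (N : ℕ) : Type
  | leaf : BFunc N → SemProof N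
  | node1 : BFunc N → SemProof N → SemProof N
  | node2 : BFunc N → SemProof N → SemProof N → SemProof N

namespace SemProof

/-- The function labelling the root. -/
def root {N : ℕ} : SemProof N → BFunc N
  | leaf f => f
  | node1 f _ => f
  | node2 f _ _ => f

/-- The length of a tree-like proof: its number of lines. -/
def length {N : ℕ} : SemProof N → ℕ
  | leaf _ => 1
  | node1 _ s => s.length + 1
  | node2 _ s t => s.length + t.length + 1

/-- A valid tree-like `sem(F)` derivation from the CNF formula `A`: every line either is
the indicator of the falsifying assignments of a clause of `A`, or belongs to `F` and is
semantically implied by its (at most two) premises. -/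
def Valid {N : ℕ} (F : Set (BFunc N)) (A : Finset (Clause N)) : SemProof N → Prop
  | leaf f => ∃ c ∈ A, f = falsInd c
  | node1 f s => ((∃ c ∈ A, f = falsInd c) ∨
      (f ∈ F ∧ ∀ α, f α = true → s.root α = true)) ∧ Valid F A s
  | node2 f s t => ((∃ c ∈ A, f = falsInd c) ∨
      (f ∈ F ∧ ∀ α, f α = true → s.root α = true ∨ t.root α = true)) ∧
      Valid F A s ∧ Valid F A t

end SemProof

/-- A tree-like `sem(F)` refutation of `A`: a valid derivation whose final line is the
constant-`1` function (ruling out every assignment, i.e. contradiction). -/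
def IsRefutation {N : ℕ} (F : Set (BFunc N)) (A : Finset (Clause N)) (π : SemProof N) : Prop :=
  SemProof.Valid F A π ∧ ∀ α, π.root α = true

/-- A tree-like `sem(F)` derivation of the function `g` from `A`. -/
def IsDerivation {N : ℕ} (F : Set (BFunc N)) (A : Finset (Clause N)) (π : SemProof N)
    (g : BFunc N) : Prop :=
  SemProof.Valid F A π ∧ π.root = g


open Classical in
/-- The binary block clique formula `bclique_b(G,k)`, a CNF formula over the variables
`{x_{i,b} : i ∈ [k], b ∈ [⌈log n⌉]}`, consisting of the edge axioms `C_{i,a} ∨ C_{j,b}`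
for all `i ≠ j` and all `a, b` with `{v_{i,a}, v_{j,b}} ∉ E(G)`, where `C_{i,a}` is the
clause falsified exactly when the variables of block `i` encode `a` in binary. -/
noncomputable def bcliqueB (k n : ℕ) (G : Finset (Sym2 (Vtx k n))) :
    Finset (Clause (k * Nat.clog 2 n)) :=
  (Finset.univ.filter fun q : Vtx k n × Vtx k n =>
      q.1.1 ≠ q.2.1 ∧ s(q.1, q.2) ∉ G).image
    fun q => (fun w =>
      if (finProdFinEquiv.symm w).1 = q.1.1 then
        some (!((q.1.2 : ℕ).testBit (finProdFinEquiv.symm w).2))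
      else if (finProdFinEquiv.symm w).1 = q.2.1 then
        some (!((q.2.2 : ℕ).testBit (finProdFinEquiv.symm w).2))
      else none : Clause (k * Nat.clog 2 n))

/-- The lines of the semantic degree-`d` threshold proof system `Th(d)`: Boolean
functions that are (indicators of the falsifying assignments of) inequalities `p ≥ 0`
for integer polynomials `p` of degree at most `d`, represented by their multilinear
coefficients. -/
def ThLines (N d : ℕ) : Set (BFunc N) :=
  {f | ∃ coeff : Finset (Fin N) → ℤ, (∀ S : Finset (Fin N), d < S.card → coeff S = 0) ∧
    ∀ α, f α = !(decide ((0 : ℤ) ≤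
      ∑ S : Finset (Fin N), coeff S * ∏ i ∈ S, (if α i then 1 else 0)))}

set_option linter.unusedSectionVars false

/-- Expectation over a random subset of `U`. -/
noncomputable def EV {α : Type*} (U : Finset α) (p : ℝ) (f : Finset α → ℝ) : ℝ :=
  ∑ G ∈ U.powerset, p ^ G.card * (1 - p) ^ (U.card - G.card) * f G

section EVsec
variable {α : Type*} [DecidableEq α] {U : Finset α} {p : ℝ}

lemma EV_insert {e : α} (he : e ∉ U) (f : Finset α → ℝ) :
    EV (insert e U) p f = p * EV U p (fun G => f (insert e G)) + (1 - p) * EV U p f := by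
  unfold EV
  rw [Finset.sum_powerset_insert he, add_comm, Finset.mul_sum, Finset.mul_sum]
  congr 1
  · refine Finset.sum_congr rfl fun G hG => ?_
    have hG' := Finset.mem_powerset.1 hG
    have : e ∉ G := fun h => he (hG' h)
    rw [Finset.card_insert_of_notMem he, Finset.card_insert_of_notMem this, Nat.add_sub_add_right]
    ring
  · refine Finset.sum_congr rfl fun G hG => ?_
    have hG' := Finset.card_le_card (Finset.mem_powerset.1 hG)
    rw [Finset.card_insert_of_notMem he, Nat.sub_add_comm hG']
    ring

lemma EV_congr {f g : Finset α → ℝ} (h : ∀ G ⊆ U, f G = g G) : EV U p f = EV U p g :=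
  Finset.sum_congr rfl fun G hG => by rw [h G (Finset.mem_powerset.1 hG)]

lemma EV_one : EV U p (fun _ => 1) = 1 := by
  induction U using Finset.induction_on with
  | empty => simp [EV]
  | insert e U he ih => rw [EV_insert he, ih]; ring

lemma EV_mono (h0 : 0 ≤ p) (h1 : p ≤ 1) {f g : Finset α → ℝ} (h : ∀ G ⊆ U, f G ≤ g G) :
    EV U p f ≤ EV U p g :=
  Finset.sum_le_sum fun G hG => mul_le_mul_of_nonneg_left (h G (Finset.mem_powerset.1 hG))
    (mul_nonneg (pow_nonneg h0 _) (pow_nonneg (by linarith) _))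

lemma EV_const_mul (c : ℝ) (f : Finset α → ℝ) : EV U p (fun G => c * f G) = c * EV U p f := by
  unfold EV
  rw [Finset.mul_sum]
  exact Finset.sum_congr rfl fun G _ => by ring

lemma EV_sum {ι : Type*} (X : Finset ι) (f : ι → Finset α → ℝ) :
    EV U p (fun G => ∑ x ∈ X, f x G) = ∑ x ∈ X, EV U p (f x) := by
  unfold EV
  rw [Finset.sum_comm]
  exact Finset.sum_congr rfl fun G _ => by rw [Finset.mul_sum]

lemma EV_sub (f g : Finset α → ℝ) :
    EV U p (fun G => f G - g G) = EV U p f - EV U p g := by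
  unfold EV
  rw [← Finset.sum_sub_distrib]
  exact Finset.sum_congr rfl fun G _ => by ring

lemma EV_nonneg (h0 : 0 ≤ p) (h1 : p ≤ 1) {f : Finset α → ℝ} (h : ∀ G, 0 ≤ f G) :
    0 ≤ EV U p f :=
  Finset.sum_nonneg fun G _ => mul_nonneg
    (mul_nonneg (pow_nonneg h0 _) (pow_nonneg (by linarith) _)) (h G)

lemma EV_single {e : α} (he : e ∈ U) (g : Finset α → ℝ)
    (hg : ∀ G, g (insert e G) = g G) :
    EV U p (fun G => (if e ∈ G then 1 else 0) * g G) = p * EV U p g := by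
  rw [← Finset.insert_erase he]
  set U' := U.erase e
  have he' : e ∉ U' := Finset.notMem_erase e U
  rw [EV_insert he', EV_insert he']
  have h1 : EV U' p (fun G => (if e ∈ G then (1:ℝ) else 0) * g G) = EV U' p (fun G => 0 * g G) :=
    EV_congr fun G hG => by rw [if_neg (fun h => he' (hG h))]
  rw [h1, EV_const_mul]
  simp only [hg, Finset.mem_insert_self, if_true, one_mul]
  ring

lemma EV_indep {E : Finset α} (hE : E ⊆ U) (g : Finset α → ℝ)
    (hg : ∀ e ∈ E, ∀ G, g (insert e G) = g G) :
    EV U p (fun G => (if E ⊆ G then 1 else 0) * g G) = p ^ E.card * EV U p g := by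
  induction E using Finset.induction_on with
  | empty => simp
  | insert e E he ih =>
    have h1 := ih (fun x hx => hE (Finset.mem_insert_of_mem hx))
      (fun x hx => hg x (Finset.mem_insert_of_mem hx))
    rw [Finset.card_insert_of_notMem he, pow_succ, mul_comm _ p, mul_assoc, ← h1,
      ← EV_single (hE (Finset.mem_insert_self e E))]
    · refine EV_congr fun G _ => ?_
      by_cases h : e ∈ G <;> by_cases h' : E ⊆ G <;> simp [Finset.insert_subset_iff, h, h']
    · intro G
      rw [hg e (Finset.mem_insert_self _ _)]
      congr 1
      simp only [Finset.subset_insert_iff_of_notMem he]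

lemma EV_ind {E : Finset α} (hE : E ⊆ U) :
    EV U p (fun G => if E ⊆ G then (1:ℝ) else 0) = p ^ E.card := by
  have := EV_indep (p := p) hE (fun _ => 1) (fun _ _ _ => rfl)
  simpa [EV_one] using this

lemma EV_fkg [Fintype α] (h0 : 0 ≤ p) (h1 : p ≤ 1) (E : Finset α) {f g : Finset α → ℝ}
    (hf0 : ∀ G, 0 ≤ f G) (hg0 : ∀ G, 0 ≤ g G) (hf : Antitone f) (hg : Antitone g) :
    EV U p (fun G => (if E ⊆ G then 1 else 0) * f G) *
      EV U p (fun G => (if E ⊆ G then 1 else 0) * g G) ≤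
    EV U p (fun G => if E ⊆ G then 1 else 0) *
      EV U p (fun G => (if E ⊆ G then 1 else 0) * (f G * g G)) := by
  set μ : (Finset α)ᵒᵈ → ℝ := fun G =>
    if G.ofDual ⊆ U ∧ E ⊆ G.ofDual then
      p ^ G.ofDual.card * (1 - p) ^ (U.card - G.ofDual.card) else 0 with hμ
  have key : ∀ h : Finset α → ℝ, EV U p (fun G => (if E ⊆ G then 1 else 0) * h G) =
      ∑ a : (Finset α)ᵒᵈ, μ a * h a.ofDual := by
    intro h
    unfold EV
    rw [← Equiv.sum_comp (OrderDual.toDual : Finset α ≃ (Finset α)ᵒᵈ)]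
    rw [← Finset.sum_subset (Finset.subset_univ U.powerset)]
    · refine Finset.sum_congr rfl fun G hG => ?_
      have := Finset.mem_powerset.1 hG
      by_cases h' : E ⊆ G <;> simp [hμ, this, h']
    · intro G _ hG
      have : ¬ G ⊆ U := fun h => hG (Finset.mem_powerset.2 h)
      simp [hμ, this]
  have key1 : EV U p (fun G => if E ⊆ G then 1 else 0) = ∑ a : (Finset α)ᵒᵈ, μ a := by
    have := key (fun _ => 1)
    simpa using this
  rw [key, key, key, key1]
  have h1p : 0 ≤ 1 - p := by linarith
  have hμ0 : 0 ≤ μ := by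
    intro a
    simp only [hμ]
    split_ifs
    · positivity
    · simp
  refine fkg (μ := μ) (f := fun a => f a.ofDual) (g := fun a => g a.ofDual) hμ0
    (fun a => hf0 _) (fun a => hg0 _) (fun a b hab => hf hab) (fun a b hab => hg hab) ?_
  intro a b
  by_cases ha : a.ofDual ⊆ U ∧ E ⊆ a.ofDual
  swap
  · rw [show μ a = 0 by simp only [hμ]; rw [if_neg ha], zero_mul]
    exact mul_nonneg (hμ0 _) (hμ0 _)
  by_cases hb : b.ofDual ⊆ U ∧ E ⊆ b.ofDual
  swap
  · rw [show μ b = 0 by simp only [hμ]; rw [if_neg hb], mul_zero]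
    exact mul_nonneg (hμ0 _) (hμ0 _)
  obtain ⟨A, rfl⟩ := OrderDual.toDual.surjective a
  obtain ⟨B, rfl⟩ := OrderDual.toDual.surjective b
  simp only [OrderDual.ofDual_toDual] at ha hb
  have hs : μ (OrderDual.toDual A ⊓ OrderDual.toDual B) =
      p ^ (A ∪ B).card * (1 - p) ^ (U.card - (A ∪ B).card) := by
    rw [← _root_.toDual_sup]
    exact if_pos ⟨Finset.union_subset ha.1 hb.1, ha.2.trans Finset.subset_union_left⟩
  have hi : μ (OrderDual.toDual A ⊔ OrderDual.toDual B) =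
      p ^ (A ∩ B).card * (1 - p) ^ (U.card - (A ∩ B).card) := by
    rw [← _root_.toDual_inf]
    exact if_pos ⟨Finset.inter_subset_left.trans ha.1, Finset.subset_inter ha.2 hb.2⟩
  rw [hs, hi]
  rw [show μ (OrderDual.toDual A) = p ^ A.card * (1 - p) ^ (U.card - A.card) from if_pos ha,
    show μ (OrderDual.toDual B) = p ^ B.card * (1 - p) ^ (U.card - B.card) from if_pos hb]
  have hc := Finset.card_union_add_card_inter A B
  have c1 := Finset.card_le_card ha.1
  have c2 := Finset.card_le_card hb.1
  have c3 := Finset.card_le_card (Finset.union_subset ha.1 hb.1)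
  have c4 := Finset.card_le_card (Finset.inter_subset_left.trans ha.1 : A ∩ B ⊆ U)
  apply le_of_eq
  calc _ = p ^ (A.card + B.card) * (1 - p) ^ ((U.card - A.card) + (U.card - B.card)) := by
        rw [pow_add, pow_add]; ring
    _ = p ^ ((A ∪ B).card + (A ∩ B).card) *
        (1 - p) ^ ((U.card - (A ∪ B).card) + (U.card - (A ∩ B).card)) := by
        congr 2 <;> omega
    _ = _ := by rw [pow_add, pow_add]; ring

end EVsec

theorem janson {α ι : Type*} [DecidableEq α] [Fintype α] {U : Finset α} {p : ℝ}
    (h0 : 0 < p) (h1 : p ≤ 1) (X : Finset ι) (E : ι → Finset α) (hE : ∀ x ∈ X, E x ⊆ U)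
    (w : ι → ℝ) (hw : ∀ x ∈ X, 0 ≤ w x) (hμ : ∑ x ∈ X, w x * p ^ (E x).card = 1)
    (Δ : ℝ) (hΔ : 0 < Δ)
    (hD : ∑ x ∈ X, ∑ y ∈ X, (if Disjoint (E x) (E y) then 0 else
      w x * w y * p ^ (E x ∪ E y).card) ≤ Δ) :
    EV U p (fun G => if ∀ x ∈ X, ¬ E x ⊆ G then 1 else 0) ≤ Real.exp (-(1 / (2 * Δ))) := by
  classical
  set S : Finset α → ℝ := fun G => ∑ x ∈ X, w x * (if E x ⊆ G then 1 else 0) with hS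
  set Lf : ℝ → ℝ := fun s => EV U p (fun G => Real.exp (-s * S G)) with hL
  have hder : ∀ s, HasDerivAt Lf (-(EV U p (fun G => S G * Real.exp (-s * S G)))) s := by
    intro s
    have : ∀ G ∈ U.powerset, HasDerivAt (fun s : ℝ => p ^ G.card * (1 - p) ^ (U.card - G.card) *
        Real.exp (-s * S G)) (p ^ G.card * (1 - p) ^ (U.card - G.card) *
          (Real.exp (-s * S G) * (-1 * S G))) s := by
      intro G _
      exact ((((hasDerivAt_id s).neg).mul_const (S G)).exp).const_mul _
    have h2 := HasDerivAt.fun_sum this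
    refine HasDerivAt.congr_deriv h2 ?_
    unfold EV
    rw [← Finset.sum_neg_distrib]
    exact Finset.sum_congr rfl fun G _ => by ring
  have hLpos : ∀ s, 0 ≤ Lf s := by
    intro s
    exact EV_nonneg h0.le h1 fun G => (Real.exp_pos _).le
  -- key estimate
  have hkey : ∀ s, 0 ≤ s → (1 - s * Δ) * Lf s ≤ EV U p (fun G => S G * Real.exp (-s * S G)) := by
    intro s hs
    have hx : ∀ x ∈ X, (p ^ (E x).card - s * ∑ y ∈ X, (if Disjoint (E x) (E y) then 0 else
        w y * p ^ (E x ∪ E y).card)) * Lf s ≤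
        EV U p (fun G => (if E x ⊆ G then 1 else 0) * Real.exp (-s * S G)) := by
      intro x hxX
      set Y : Finset α → ℝ := fun G => ∑ y ∈ X, (if Disjoint (E x) (E y) then 0 else
        w y * (if E y ⊆ G then 1 else 0)) with hY
      set Z : Finset α → ℝ := fun G => ∑ y ∈ X, (if Disjoint (E x) (E y) then
        w y * (if E y ⊆ G then 1 else 0) else 0) with hZ
      have hSYZ : ∀ G, S G = Y G + Z G := by
        intro G
        simp only [hS, hY, hZ]
        rw [← Finset.sum_add_distrib]
        refine Finset.sum_congr rfl fun y _ => ?_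
        by_cases h : Disjoint (E x) (E y) <;> simp [h]
      have hind : ∀ y, Monotone (fun G : Finset α => (if E y ⊆ G then (1:ℝ) else 0)) := by
        intro y G H hGH
        by_cases h : E y ⊆ G
        · simp [h, h.trans hGH]
        · simp only [h, if_false]
          split_ifs <;> norm_num
      have hYm : Monotone Y := by
        intro G H hGH
        refine Finset.sum_le_sum fun y hy => ?_
        by_cases h : Disjoint (E x) (E y)
        · simp [h]
        · simp only [h, if_false]
          exact mul_le_mul_of_nonneg_left (hind y hGH) (hw y hy)
      have hZm : Monotone Z := by
        intro G H hGH
        refine Finset.sum_le_sum fun y hy => ?_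
        by_cases h : Disjoint (E x) (E y)
        · simp only [h, if_true]
          exact mul_le_mul_of_nonneg_left (hind y hGH) (hw y hy)
        · simp [h]
      have hY0 : ∀ G, 0 ≤ Y G := by
        intro G
        refine Finset.sum_nonneg fun y hy => ?_
        split_ifs <;> simp [hw y hy]
      have hanti : ∀ W : Finset α → ℝ, Monotone W → Antitone (fun G => Real.exp (-s * W G)) := by
        intro W hW G H hGH
        apply Real.exp_le_exp.2
        have := mul_le_mul_of_nonneg_left (hW hGH) hs
        linarith
      have hfkg := EV_fkg (U := U) h0.le h1 (E x) (f := fun G => Real.exp (-s * Y G))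
        (g := fun G => Real.exp (-s * Z G)) (fun G => (Real.exp_pos _).le)
        (fun G => (Real.exp_pos _).le) (hanti Y hYm) (hanti Z hZm)
      have e1 : EV U p (fun G => (if E x ⊆ G then 1 else 0) *
          (Real.exp (-s * Y G) * Real.exp (-s * Z G))) =
          EV U p (fun G => (if E x ⊆ G then 1 else 0) * Real.exp (-s * S G)) := by
        refine EV_congr fun G _ => ?_
        rw [← Real.exp_add, hSYZ]
        ring_nf
      rw [e1, EV_ind (hE x hxX)] at hfkg
      have e2 : EV U p (fun G => (if E x ⊆ G then 1 else 0) * Real.exp (-s * Z G)) =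
          p ^ (E x).card * EV U p (fun G => Real.exp (-s * Z G)) := by
        refine EV_indep (hE x hxX) _ ?_
        intro e he G
        congr 2
        simp only [hZ]
        refine Finset.sum_congr rfl fun y _ => ?_
        by_cases h : Disjoint (E x) (E y)
        · have : e ∉ E y := Finset.disjoint_left.1 h he
          simp only [h, if_true, Finset.subset_insert_iff_of_notMem this]
        · simp [h]
      have e3 : Lf s ≤ EV U p (fun G => Real.exp (-s * Z G)) := by
        refine EV_mono h0.le h1 fun G _ => Real.exp_le_exp.2 ?_
        rw [hSYZ]
        nlinarith [hY0 G]
      have e4 : p ^ (E x).card - s * ∑ y ∈ X, (if Disjoint (E x) (E y) then 0 else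
          w y * p ^ (E x ∪ E y).card) ≤
          EV U p (fun G => (if E x ⊆ G then 1 else 0) * Real.exp (-s * Y G)) := by
        have : p ^ (E x).card - s * ∑ y ∈ X, (if Disjoint (E x) (E y) then 0 else
            w y * p ^ (E x ∪ E y).card) =
            EV U p (fun G => (if E x ⊆ G then 1 else 0) - s * ∑ y ∈ X,
              (if Disjoint (E x) (E y) then 0 else w y) * (if E x ∪ E y ⊆ G then 1 else 0)) := by
          rw [EV_sub, EV_ind (hE x hxX), EV_const_mul, EV_sum]
          congr 2
          refine Finset.sum_congr rfl fun y hy => ?_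
          rw [EV_const_mul, EV_ind (Finset.union_subset (hE x hxX) (hE y hy))]
          split_ifs <;> simp
        rw [this]
        refine EV_mono h0.le h1 fun G _ => ?_
        have hexp := Real.add_one_le_exp (-s * Y G)
        by_cases hG : E x ⊆ G
        · have : ∑ y ∈ X, (if Disjoint (E x) (E y) then 0 else w y) *
              (if E x ∪ E y ⊆ G then 1 else 0) = Y G := by
            simp only [hY]
            refine Finset.sum_congr rfl fun y _ => ?_
            by_cases h : Disjoint (E x) (E y) <;> by_cases h' : E y ⊆ G <;>
              simp [h, h', hG, Finset.union_subset_iff]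
          rw [this]
          simp only [hG, if_true]
          linarith
        · simp only [hG, if_false, Finset.union_subset_iff, false_and, mul_zero,
            Finset.sum_const_zero]
          simp
      have hppos : 0 < p ^ (E x).card := by positivity
      rw [e2] at hfkg
      set V := EV U p (fun G => (if E x ⊆ G then 1 else 0) * Real.exp (-s * Y G))
      have hV0 : 0 ≤ V := EV_nonneg h0.le h1 fun G =>
        mul_nonneg (by split_ifs <;> norm_num) (Real.exp_pos _).le
      have h5 : V * EV U p (fun G => Real.exp (-s * Z G)) ≤
          EV U p (fun G => (if E x ⊆ G then 1 else 0) * Real.exp (-s * S G)) := by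
        refine le_of_mul_le_mul_left ?_ hppos
        linarith
      calc _ ≤ V * Lf s := mul_le_mul_of_nonneg_right e4 (hLpos s)
        _ ≤ V * EV U p (fun G => Real.exp (-s * Z G)) := mul_le_mul_of_nonneg_left e3 hV0
        _ ≤ _ := h5
    have e6 : EV U p (fun G => S G * Real.exp (-s * S G)) = ∑ x ∈ X, w x *
        EV U p (fun G => (if E x ⊆ G then 1 else 0) * Real.exp (-s * S G)) := by
      simp_rw [← EV_const_mul]
      rw [← EV_sum]
      refine EV_congr fun G _ => ?_
      rw [← Finset.sum_congr rfl (fun x _ => mul_assoc _ _ _), ← Finset.sum_mul]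
    rw [e6]
    have e7 := Finset.sum_le_sum fun x hx' => mul_le_mul_of_nonneg_left (hx x hx') (hw x hx')
    refine le_trans ?_ e7
    have e8 : ∑ x ∈ X, w x * ((p ^ (E x).card - s * ∑ y ∈ X, (if Disjoint (E x) (E y) then 0 else
        w y * p ^ (E x ∪ E y).card)) * Lf s) =
        (∑ x ∈ X, w x * p ^ (E x).card - s * ∑ x ∈ X, ∑ y ∈ X,
          (if Disjoint (E x) (E y) then 0 else w x * w y * p ^ (E x ∪ E y).card)) * Lf s := by
      rw [Finset.mul_sum, ← Finset.sum_sub_distrib, Finset.sum_mul]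
      refine Finset.sum_congr rfl fun x _ => ?_
      have : ∑ y ∈ X, (if Disjoint (E x) (E y) then 0 else w x * w y * p ^ (E x ∪ E y).card)
          = w x * ∑ y ∈ X, (if Disjoint (E x) (E y) then 0 else w y * p ^ (E x ∪ E y).card) := by
        rw [Finset.mul_sum]
        refine Finset.sum_congr rfl fun y _ => ?_
        split_ifs <;> ring
      rw [this]
      ring
    rw [e8, hμ]
    refine mul_le_mul_of_nonneg_right ?_ (hLpos s)
    nlinarith
  set g : ℝ → ℝ := fun s => Lf s * Real.exp (s - s ^ 2 * Δ / 2) with hg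
  have hgder : ∀ s, HasDerivAt g (-(EV U p (fun G => S G * Real.exp (-s * S G))) *
      Real.exp (s - s ^ 2 * Δ / 2) + Lf s * (Real.exp (s - s ^ 2 * Δ / 2) * (1 - s * Δ))) s := by
    intro s
    have h2 : HasDerivAt (fun s : ℝ => s - s ^ 2 * Δ / 2) (1 - s * Δ) s := by
      have := (hasDerivAt_id s).sub ((((hasDerivAt_id s).pow 2).mul_const Δ).div_const 2)
      refine this.congr_deriv ?_
      simp only [id_eq]
      ring
    exact (hder s).mul h2.exp
  have hanti : AntitoneOn g (Set.Ici 0) := by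
    refine antitoneOn_of_deriv_nonpos (convex_Ici 0)
      (fun s _ => (hgder s).continuousAt.continuousWithinAt)
      (fun s _ => (hgder s).differentiableAt.differentiableWithinAt) ?_
    intro s hs
    rw [interior_Ici] at hs
    rw [(hgder s).deriv]
    have := mul_le_mul_of_nonneg_right (hkey s (le_of_lt hs)) (Real.exp_pos (s - s ^ 2 * Δ / 2)).le
    nlinarith
  have h3 := hanti (Set.mem_Ici.2 le_rfl) (Set.mem_Ici.2 (by positivity : (0:ℝ) ≤ 1 / Δ))
    (by positivity)
  have hg0 : g 0 = 1 := by simp [hg, hL, EV_one]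
  rw [hg0] at h3
  have h4 : Lf (1 / Δ) ≤ Real.exp (-(1 / (2 * Δ))) := by
    have e : (1 / Δ) - (1 / Δ) ^ 2 * Δ / 2 = 1 / (2 * Δ) := by field_simp; ring
    simp only [hg] at h3
    rw [e] at h3
    rw [Real.exp_neg, ← one_div, le_div_iff₀ (Real.exp_pos _)]
    exact h3
  refine le_trans ?_ h4
  refine EV_mono h0.le h1 fun G _ => ?_
  split_ifs with h
  · have : S G = 0 := Finset.sum_eq_zero fun x hx => by simp [h x hx]
    simp [this]
  · exact (Real.exp_pos _).le

open Classical in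
/-- The tuples of `Z` agreeing with `b` on `A`. -/
noncomputable def agr {k n : ℕ} (Z : Finset (Tup k n)) (A : Finset (Fin k)) (b : Tup k n) :
    Finset (Tup k n) := Z.filter fun x => ∀ i ∈ A, x i = b i

lemma mem_agr {k n : ℕ} {Z : Finset (Tup k n)} {A : Finset (Fin k)} {b x : Tup k n} :
    x ∈ agr Z A b ↔ x ∈ Z ∧ ∀ i ∈ A, x i = b i := by
  simp [agr]

/-- `Z` is blockwise spread outside `I`. -/
def Spread {k n : ℕ} (r lam : ℝ) (Z : Finset (Tup k n)) (I : Finset (Fin k)) : Prop :=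
  ∀ A, Disjoint A I → ∀ b, ((agr Z A b).card : ℝ) ≤ lam * r ^ A.card * Z.card

/-- `Q` has a large spread part above the partial tuple `a` on `I`. -/
def PGood {k n : ℕ} (r : ℝ) (Q : Finset (Tup k n)) (I : Finset (Fin k)) (a : Tup k n)
    (M : ℝ) : Prop :=
  ∃ Z ⊆ Q, (∀ x ∈ Z, ∀ i ∈ I, x i = a i) ∧ Spread r 1 Z I ∧ M ≤ Z.card

/-- The partial tuple `a` on `I` is a clique in `G`. -/
def CliqueOn {k n : ℕ} (G : Finset (Sym2 (Vtx k n))) (I : Finset (Fin k)) (a : Tup k n) : Prop :=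
  ∀ i ∈ I, ∀ j ∈ I, i ≠ j → tupEdge a i j ∈ G

lemma restore {k n : ℕ} {r : ℝ} (hr : 0 < r) {Q Y : Finset (Tup k n)} {I : Finset (Fin k)}
    {a : Tup k n} (hYQ : Y ⊆ Q) (hYne : Y.Nonempty) (hYa : ∀ x ∈ Y, ∀ i ∈ I, x i = a i) :
    ∃ x ∈ Y, ∃ A, Disjoint A I ∧ PGood r Q (I ∪ A) x (Y.card * r ^ A.card) := by
  classical
  obtain ⟨y0, hy0⟩ := hYne
  obtain ⟨⟨A, x⟩, hAx, hmax⟩ := Finset.exists_max_image ((Iᶜ).powerset ×ˢ Y)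
    (fun q => ((agr Y q.1 q.2).card : ℝ) / r ^ q.1.card) ⟨(∅, y0), by simp [hy0]⟩
  simp only [Finset.mem_product, Finset.mem_powerset] at hAx
  have hdis : Disjoint A I := by
    rw [Finset.disjoint_left]
    intro i hi
    simpa using hAx.1 hi
  refine ⟨x, hAx.2, A, hdis, agr Y A x, (Finset.filter_subset _ _).trans hYQ, ?_, ?_, ?_⟩
  · intro z hz i hi
    rw [mem_agr] at hz
    rcases Finset.mem_union.1 hi with h | h
    · rw [hYa z hz.1 i h, hYa x hAx.2 i h]
    · exact hz.2 i h
  · intro B hB b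
    rcases (agr (agr Y A x) B b).eq_empty_or_nonempty with he | ⟨y, hy⟩
    · rw [he]
      simp only [Finset.card_empty, Nat.cast_zero]
      positivity
    · rw [mem_agr, mem_agr] at hy
      have heq : agr (agr Y A x) B b = agr Y (A ∪ B) y := by
        ext z
        simp only [mem_agr, Finset.mem_union]
        constructor
        · rintro ⟨⟨h1, h2⟩, h3⟩
          refine ⟨h1, fun i hi => ?_⟩
          rcases hi with h | h
          · rw [h2 i h, hy.1.2 i h]
          · rw [h3 i h, hy.2 i h]
        · rintro ⟨h1, h2⟩
          refine ⟨⟨h1, fun i hi => ?_⟩, fun i hi => ?_⟩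
          · rw [h2 i (Or.inl hi), hy.1.2 i hi]
          · rw [h2 i (Or.inr hi), hy.2 i hi]
      have hBA : Disjoint A B := (Finset.disjoint_union_right.1 hB).2.symm
      have := hmax (A ∪ B, y) (by
        simp only [Finset.mem_product, Finset.mem_powerset]
        refine ⟨Finset.union_subset hAx.1 ?_, hy.1.1⟩
        intro i hi
        rw [Finset.mem_compl]
        exact fun h => Finset.disjoint_left.1 hB hi (Finset.mem_union_left _ h))
      simp only at this
      rw [heq, one_mul]
      rw [Finset.card_union_of_disjoint hBA, div_le_div_iff₀ (by positivity) (by positivity),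
        pow_add] at this
      have hrA : 0 < r ^ A.card := by positivity
      refine le_of_mul_le_mul_right ?_ hrA
      linarith
  · have := hmax (∅, y0) (by simp [hy0])
    have h2 : agr Y ∅ y0 = Y := by simp [agr]
    simp only [h2, Finset.card_empty, pow_zero, div_one] at this
    rwa [le_div_iff₀ (by positivity)] at this

lemma PGood.mono {k n : ℕ} {r : ℝ} {Q : Finset (Tup k n)} {I : Finset (Fin k)} {a : Tup k n}
    {M M' : ℝ} (h : PGood r Q I a M) (hM : M' ≤ M) : PGood r Q I a M' := by
  obtain ⟨Z, h1, h2, h3, h4⟩ := h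
  exact ⟨Z, h1, h2, h3, hM.trans h4⟩

open Classical in
lemma many {k n : ℕ} {r : ℝ} (hr : 0 < r) {Q Z : Finset (Tup k n)} {I : Finset (Fin k)}
    {a : Tup k n} (hZQ : Z ⊆ Q) (hZa : ∀ x ∈ Z, ∀ i ∈ I, x i = a i) :
    (Z.card : ℝ) / 2 ≤ (Z.filter fun x => ∃ A, Disjoint A I ∧
      PGood r Q (I ∪ A) x (Z.card / 2 * r ^ A.card)).card := by
  by_contra hcon
  push Not at hcon
  set X := Z.filter fun x => ∃ A, Disjoint A I ∧
      PGood r Q (I ∪ A) x (Z.card / 2 * r ^ A.card) with hX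
  have hXZ : X ⊆ Z := Finset.filter_subset _ _
  have hc := Finset.card_sdiff_add_card_eq_card hXZ
  have hc' : ((Z \ X).card : ℝ) + X.card = Z.card := by exact_mod_cast hc
  have hpos : (Z.card : ℝ) / 2 < ((Z \ X).card : ℝ) := by linarith
  have hne : (Z \ X).Nonempty := by
    rw [← Finset.card_pos]
    have : (0 : ℝ) ≤ (Z.card : ℝ) / 2 := by positivity
    exact_mod_cast lt_of_le_of_lt this hpos
  obtain ⟨x, hx, A, hA, hP⟩ := restore hr (Finset.sdiff_subset.trans hZQ) hne
    (fun x hx => hZa x (Finset.sdiff_subset hx)) (I := I) (a := a)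
  rw [Finset.mem_sdiff] at hx
  refine hx.2 ?_
  rw [hX, Finset.mem_filter]
  exact ⟨hx.1, A, hA, hP.mono (mul_le_mul_of_nonneg_right hpos.le (by positivity))⟩

lemma card_agr_univ {k n : ℕ} (C : Finset (Fin k)) (x : Tup k n) :
    (agr univ C x).card * n ^ C.card = n ^ k := by
  classical
  have : agr univ C x = Fintype.piFinset (fun i => if i ∈ C then {x i} else univ) := by
    ext z
    simp only [mem_agr, Finset.mem_univ, true_and, Fintype.mem_piFinset]
    refine forall_congr' fun i => ?_
    by_cases h : i ∈ C <;> simp [h]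
  rw [this, Fintype.card_piFinset]
  have h2 : ∀ i, (if i ∈ C then ({x i} : Finset (Fin n)) else univ).card =
      if i ∈ C then 1 else n := by
    intro i
    by_cases h : i ∈ C <;> simp [h]
  simp_rw [h2]
  have h3 : n ^ C.card = ∏ i : Fin k, if i ∈ C then n else 1 := by
    rw [Finset.prod_ite_mem]; simp
  rw [h3, ← Finset.prod_mul_distrib]
  have h4 : ∀ i : Fin k, (if i ∈ C then 1 else n) * (if i ∈ C then n else 1) = n := by
    intro i
    by_cases h : i ∈ C <;> simp [h]
  simp_rw [h4]
  simp

lemma PGood.card_le {k n : ℕ} {r : ℝ} {Q : Finset (Tup k n)} {I : Finset (Fin k)} {a : Tup k n}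
    {M : ℝ} (h : PGood r Q I a M) : M * (n : ℝ) ^ I.card ≤ (n : ℝ) ^ k := by
  obtain ⟨Z, h1, h2, h3, h4⟩ := h
  have h5 : Z.card ≤ (agr univ I a).card :=
    Finset.card_le_card fun x hx => mem_agr.2 ⟨Finset.mem_univ _, h2 x hx⟩
  have h6 := card_agr_univ I a
  calc M * (n : ℝ) ^ I.card ≤ ((agr univ I a).card : ℝ) * (n : ℝ) ^ I.card := by
        gcongr
        exact h4.trans (by exact_mod_cast h5)
    _ = (n : ℝ) ^ k := by exact_mod_cast h6

open Classical in
/-- The edges of the tuple `x` inside `W` that are not inside `I`. -/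
noncomputable def newEdges {k n : ℕ} (I W : Finset (Fin k)) (x : Tup k n) :
    Finset (Sym2 (Vtx k n)) :=
  ((W ×ˢ W).filter fun q => q.1 ≠ q.2 ∧ q.1 ∉ I).image fun q => tupEdge x q.1 q.2

lemma mem_newEdges {k n : ℕ} {I W : Finset (Fin k)} {x : Tup k n} {e : Sym2 (Vtx k n)} :
    e ∈ newEdges I W x ↔ ∃ i j, i ∈ W ∧ j ∈ W ∧ i ≠ j ∧ i ∉ I ∧ tupEdge x i j = e := by
  classical
  simp only [newEdges, Finset.mem_image, Finset.mem_filter, Finset.mem_product, Prod.exists]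
  constructor
  · rintro ⟨i, j, ⟨⟨h1, h2⟩, h3, h4⟩, h5⟩
    exact ⟨i, j, h1, h2, h3, h4, h5⟩
  · rintro ⟨i, j, h1, h2, h3, h4, h5⟩
    exact ⟨i, j, ⟨⟨h1, h2⟩, h3, h4⟩, h5⟩

lemma newEdges_subset {k n : ℕ} (I W : Finset (Fin k)) (x : Tup k n) :
    newEdges I W x ⊆ potEdges k n := by
  intro e he
  obtain ⟨i, j, _, _, hij, _, rfl⟩ := mem_newEdges.1 he
  simp [potEdges, tupEdge, hij]

lemma tupEdge_comm {k n : ℕ} (x : Tup k n) (i j : Fin k) : tupEdge x i j = tupEdge x j i :=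
  Sym2.eq_swap

lemma cliqueOn_of_newEdges {k n : ℕ} {G : Finset (Sym2 (Vtx k n))} {I W : Finset (Fin k)}
    {a x : Tup k n} (hxa : ∀ i ∈ I, x i = a i) (hI : CliqueOn G I a)
    (hE : newEdges I W x ⊆ G) : CliqueOn G W x := by
  intro i hi j hj hij
  by_cases h1 : i ∈ I
  · by_cases h2 : j ∈ I
    · have : tupEdge x i j = tupEdge a i j := by simp [tupEdge, hxa i h1, hxa j h2]
      rw [this]
      exact hI i h1 j h2 hij
    · rw [tupEdge_comm]
      exact hE (mem_newEdges.2 ⟨j, i, hj, hi, hij.symm, h2, rfl⟩)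
  · exact hE (mem_newEdges.2 ⟨i, j, hi, hj, hij, h1, rfl⟩)

lemma agree_of_mem {k n : ℕ} {I W : Finset (Fin k)} {x y : Tup k n} {i j : Fin k}
    {W' : Finset (Fin k)} (h : tupEdge x i j ∈ newEdges I W' y) (_ : W = W) : x i = y i := by
  obtain ⟨i', j', _, _, _, _, he⟩ := mem_newEdges.1 h
  simp only [tupEdge, Sym2.eq_iff, Prod.mk.injEq] at he
  rcases he with ⟨⟨rfl, h1⟩, _⟩ | ⟨_, ⟨rfl, h1⟩⟩
  · exact h1.symm
  · exact h1.symm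

open Classical in
lemma inter_card_le {k n : ℕ} {I W W' : Finset (Fin k)} {x y : Tup k n} :
    (newEdges I W x ∩ newEdges I W' y).card ≤
      (Iᶜ.filter fun i => x i = y i).card * W.card := by
  rw [← Finset.card_product]
  refine (Finset.card_le_card ?_).trans (Finset.card_image_le (f := fun q => tupEdge x q.1 q.2))
  intro e he
  rw [Finset.mem_inter] at he
  obtain ⟨i, j, h1, h2, h3, h4, rfl⟩ := mem_newEdges.1 he.1
  refine Finset.mem_image.2 ⟨(i, j), ?_, rfl⟩
  simp only [Finset.mem_product, Finset.mem_filter, Finset.mem_compl]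
  exact ⟨⟨h4, agree_of_mem (W := W) he.2 rfl⟩, h2⟩

lemma one_add_pow_bound {k l : ℕ} (hl : l ≤ k) {y : ℝ} (hy : 0 ≤ y) (hky : k * y ≤ 1) :
    (1 + y) ^ l - 1 ≤ 2 * (k * y) := by
  have h1 : (1 + y) ^ l ≤ (1 + y) ^ k := pow_le_pow_right₀ (by linarith) hl
  have h2 : (1 + y) ^ k ≤ Real.exp (k * y) := by
    rw [Real.exp_nat_mul]
    gcongr
    linarith [Real.add_one_le_exp y]
  have h0 : 0 ≤ k * y := by positivity
  have h3 := Real.abs_exp_sub_one_le (x := k * y) (by rw [abs_of_nonneg h0]; exact hky)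
  rw [abs_of_nonneg h0] at h3
  linarith [le_abs_self (Real.exp (k * y) - 1)]

lemma sum_nonempty_powerset {β : Type*} [DecidableEq β] (s : Finset β) (y : ℝ) :
    ∑ C ∈ s.powerset.erase ∅, y ^ C.card = (1 + y) ^ s.card - 1 := by
  have := Finset.sum_pow_mul_eq_add_pow y 1 s
  simp only [one_pow, mul_one] at this
  rw [add_comm 1 y, ← this, ← Finset.add_sum_erase _ _ (Finset.empty_mem_powerset s)]
  simp

open Classical in
theorem fail_prob {k n m : ℕ} {p r τ : ℝ} (hk : 0 < k) (hn : 0 < n) (hp0 : 0 < p) (hp1 : p ≤ 1)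
    (hr : 0 < r) (hτ : 0 < τ)
    (hm : ∀ l : ℕ, τ / 2 * ((n : ℝ) * r) ^ l ≤ 1 → l ≤ m)
    (hky : k * (r * (p⁻¹) ^ m) ≤ 1)
    {Q Z : Finset (Tup k n)} {I : Finset (Fin k)} {a : Tup k n}
    (hZQ : Z ⊆ Q) (hZa : ∀ x ∈ Z, ∀ i ∈ I, x i = a i) (hsp : Spread r 2 Z I)
    (hZc : τ * (n : ℝ) ^ k * r ^ I.card ≤ Z.card) :
    EV (potEdges k n) p (fun G => if CliqueOn G I a ∧ ¬ ∃ x ∈ Z, ∃ A, Disjoint A I ∧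
      PGood r Q (I ∪ A) x (Z.card / 2 * r ^ A.card) ∧ CliqueOn G (I ∪ A) x then 1 else 0) ≤
      Real.exp (-(1 / (2 * (8 * (k * (r * (p⁻¹) ^ m)))))) := by
  set q : ℝ := (p⁻¹) ^ m with hq
  have hp1' : 1 ≤ p⁻¹ := (one_le_inv₀ hp0).2 hp1
  have hq0 : 0 < q := by positivity
  set X := Z.filter fun x => ∃ A, Disjoint A I ∧
      PGood r Q (I ∪ A) x (Z.card / 2 * r ^ A.card) with hX
  have hXc : (Z.card : ℝ) / 2 ≤ X.card := many hr hZQ hZa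
  have hn' : (0 : ℝ) < n := by exact_mod_cast hn
  have hk' : (0 : ℝ) < k := by exact_mod_cast hk
  have hZpos : (0 : ℝ) < Z.card := lt_of_lt_of_le (by positivity) hZc
  have hXpos : (0 : ℝ) < X.card := by linarith
  have hXA : ∀ x, ∃ A, x ∈ X → Disjoint A I ∧
      PGood r Q (I ∪ A) x (Z.card / 2 * r ^ A.card) := by
    intro x
    by_cases hx : x ∈ X
    · obtain ⟨A, hA⟩ := (Finset.mem_filter.1 hx).2
      exact ⟨A, fun _ => hA⟩
    · exact ⟨∅, fun h => absurd h hx⟩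
  choose A hA using hXA
  have hXZ : X ⊆ Z := Finset.filter_subset _ _
  have hcard : ∀ x ∈ X, (I ∪ A x).card ≤ m := by
    intro x hx
    apply hm
    have h1 := (hA x hx).2.card_le
    have h2 : (I ∪ A x).card = I.card + (A x).card :=
      Finset.card_union_of_disjoint (hA x hx).1.symm
    have hnk : 0 < (n : ℝ) ^ k := by positivity
    have h3 : τ * (n : ℝ) ^ k * r ^ I.card / 2 * r ^ (A x).card * (n : ℝ) ^ (I ∪ A x).card
        ≤ (n : ℝ) ^ k := by
      refine le_trans ?_ h1
      gcongr
    have h4 : τ * (n : ℝ) ^ k * r ^ I.card / 2 * r ^ (A x).card * (n : ℝ) ^ (I ∪ A x).card =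
        (τ / 2 * ((n : ℝ) * r) ^ (I ∪ A x).card) * (n : ℝ) ^ k := by
      rw [mul_pow, h2, pow_add r]
      ring
    rw [h4] at h3
    nlinarith
  set E : Tup k n → Finset (Sym2 (Vtx k n)) := fun x => newEdges I (I ∪ A x) x with hE
  set w : Tup k n → ℝ := fun x => (p ^ (E x).card)⁻¹ * (X.card : ℝ)⁻¹ with hw
  have hpw : ∀ j : ℕ, (0 : ℝ) < p ^ j := fun j => by positivity
  have hJ := janson (U := potEdges k n) hp0 hp1 X E (fun x _ => newEdges_subset _ _ _) w
    (fun x _ => by simp only [hw]; positivity)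
    (by
      have : ∀ x ∈ X, w x * p ^ (E x).card = (X.card : ℝ)⁻¹ := by
        intro x _
        simp only [hw]
        have := (hpw (E x).card).ne'
        field_simp
      rw [Finset.sum_congr rfl this, Finset.sum_const, nsmul_eq_mul]
      exact mul_inv_cancel₀ hXpos.ne')
    (8 * (k * (r * q))) (by positivity) ?_
  · refine le_trans ?_ hJ
    refine EV_mono hp0.le hp1 fun G _ => ?_
    by_cases h : CliqueOn G I a ∧ ¬ ∃ x ∈ Z, ∃ A, Disjoint A I ∧
      PGood r Q (I ∪ A) x (Z.card / 2 * r ^ A.card) ∧ CliqueOn G (I ∪ A) x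
    · rw [if_pos h, if_pos]
      intro x hx hxE
      refine h.2 ⟨x, hXZ hx, A x, (hA x hx).1, (hA x hx).2, ?_⟩
      exact cliqueOn_of_newEdges (hZa x (hXZ hx)) h.1 hxE
    · rw [if_neg h]
      split_ifs <;> norm_num
  · -- the bound on pairs
    have hpt : ∀ x ∈ X, ∀ y ∈ X, (if Disjoint (E x) (E y) then 0 else
        w x * w y * p ^ (E x ∪ E y).card) ≤ (X.card : ℝ)⁻¹ * (X.card : ℝ)⁻¹ *
        ∑ C ∈ (Iᶜ).powerset.erase ∅, (if ∀ i ∈ C, y i = x i then q ^ C.card else 0) := by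
      intro x hx y _
      have hnn : ∀ C ∈ (Iᶜ).powerset.erase ∅,
          0 ≤ (if ∀ i ∈ C, y i = x i then q ^ C.card else 0) := by
        intro C _
        split_ifs <;> positivity
      split_ifs with hd
      · exact mul_nonneg (by positivity) (Finset.sum_nonneg hnn)
      · set B := Iᶜ.filter fun i => x i = y i with hB
        have hBm : B ∈ (Iᶜ).powerset.erase ∅ := by
          rw [Finset.mem_erase, Finset.mem_powerset]
          refine ⟨?_, Finset.filter_subset _ _⟩
          obtain ⟨e, he1, he2⟩ := Finset.not_disjoint_iff.1 hd
          obtain ⟨i, j, h1, h2, h3, h4, rfl⟩ := mem_newEdges.1 he1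
          apply Finset.Nonempty.ne_empty
          refine ⟨i, ?_⟩
          rw [hB, Finset.mem_filter, Finset.mem_compl]
          exact ⟨h4, agree_of_mem (W := I) he2 rfl⟩
        have hle := Finset.single_le_sum hnn hBm
        rw [if_pos (fun i hi => ((Finset.mem_filter.1 hi).2).symm)] at hle
        have hcap : (E x ∩ E y).card ≤ m * B.card := by
          refine (inter_card_le).trans ?_
          rw [mul_comm]
          exact Nat.mul_le_mul_right _ (hcard x hx)
        have hcu := Finset.card_union_add_card_inter (E x) (E y)
        have heq : w x * w y * p ^ (E x ∪ E y).card =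
            (X.card : ℝ)⁻¹ * (X.card : ℝ)⁻¹ * (p⁻¹) ^ (E x ∩ E y).card := by
          simp only [hw]
          have e1 : p ^ (E x).card * p ^ (E y).card =
              p ^ (E x ∪ E y).card * p ^ (E x ∩ E y).card := by
            rw [← pow_add, ← pow_add, hcu]
          have n1 := (hpw (E x).card).ne'
          have n2 := (hpw (E y).card).ne'
          have n3 := (hpw (E x ∩ E y).card).ne'
          rw [inv_pow]
          field_simp
          linarith
        rw [heq]
        refine mul_le_mul_of_nonneg_left ?_ (by positivity)
        refine le_trans ?_ hle
        rw [hq, ← pow_mul]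
        exact pow_le_pow_right₀ hp1' hcap
    have hrow : ∀ x ∈ X, ∑ y ∈ X, (if Disjoint (E x) (E y) then 0 else
        w x * w y * p ^ (E x ∪ E y).card) ≤ (X.card : ℝ)⁻¹ * (8 * (k * (r * q))) := by
      intro x hx
      refine (Finset.sum_le_sum (hpt x hx)).trans ?_
      rw [← Finset.mul_sum, Finset.sum_comm, mul_assoc]
      refine mul_le_mul_of_nonneg_left ?_ (by positivity)
      have hC : ∀ C ∈ (Iᶜ).powerset.erase ∅,
          ∑ y ∈ X, (if ∀ i ∈ C, y i = x i then q ^ C.card else 0) ≤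
          4 * X.card * (r * q) ^ C.card := by
        intro C hC
        rw [Finset.mem_erase, Finset.mem_powerset] at hC
        have hCd : Disjoint C I := by
          rw [Finset.disjoint_left]
          intro i hi
          simpa using hC.2 hi
        rw [← Finset.sum_filter, Finset.sum_const, nsmul_eq_mul]
        have h1 : ((X.filter fun y => ∀ i ∈ C, y i = x i).card : ℝ) ≤ (agr Z C x).card := by
          have : X.filter (fun y => ∀ i ∈ C, y i = x i) ⊆ agr Z C x := by
            intro y hy
            rw [Finset.mem_filter] at hy
            exact mem_agr.2 ⟨hXZ hy.1, hy.2⟩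
          exact_mod_cast Finset.card_le_card this
        have h2 := hsp C hCd x
        calc _ ≤ (2 * r ^ C.card * Z.card) * q ^ C.card := by
              gcongr
              exact h1.trans h2
          _ ≤ (2 * r ^ C.card * (2 * X.card)) * q ^ C.card := by
              gcongr
              linarith
          _ = _ := by rw [mul_pow]; ring
      have h3 := Finset.sum_le_sum hC
      rw [← Finset.mul_sum, sum_nonempty_powerset] at h3
      have h4 := one_add_pow_bound (k := k) (l := (Iᶜ).card)
        ((Finset.card_le_univ _).trans (by simp)) (y := r * q) (by positivity) hky
      calc _ ≤ (X.card : ℝ)⁻¹ * (4 * X.card * ((1 + r * q) ^ (Iᶜ).card - 1)) := by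
            gcongr
        _ ≤ (X.card : ℝ)⁻¹ * (4 * X.card * (2 * (k * (r * q)))) := by gcongr
        _ = _ := by field_simp; ring
    refine (Finset.sum_le_sum hrow).trans ?_
    rw [Finset.sum_const, nsmul_eq_mul, ← mul_assoc, mul_inv_cancel₀ hXpos.ne', one_mul]

/-- Every large spread part of `Q` above the partial clique `a` on `I` extends. -/
def JProp {k n : ℕ} (r τ : ℝ) (G : Finset (Sym2 (Vtx k n))) (Q : Finset (Tup k n))
    (I : Finset (Fin k)) (a : Tup k n) : Prop :=
  ∀ Z ⊆ Q, (∀ x ∈ Z, ∀ i ∈ I, x i = a i) → Spread r 2 Z I →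
    τ * n ^ k * r ^ I.card ≤ Z.card → CliqueOn G I a →
    ∃ x : Tup k n, ∃ A, Disjoint A I ∧ PGood r Q (I ∪ A) x (Z.card / 2 * r ^ A.card) ∧
      CliqueOn G (I ∪ A) x

open Classical in
theorem JProp_fail {k n m : ℕ} {p r τ : ℝ} (hk : 0 < k) (hn : 0 < n) (hp0 : 0 < p)
    (hp1 : p ≤ 1) (hr : 0 < r) (hτ : 0 < τ)
    (hm : ∀ l : ℕ, τ / 2 * ((n : ℝ) * r) ^ l ≤ 1 → l ≤ m)
    (hky : k * (r * (p⁻¹) ^ m) ≤ 1) (Q : Finset (Tup k n)) (I : Finset (Fin k)) (a : Tup k n) :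
    EV (potEdges k n) p (fun G => if ¬ JProp r τ G Q I a then 1 else 0) ≤
      Real.exp (-(1 / (2 * (8 * (k * (r * (p⁻¹) ^ m)))))) := by
  set S : Finset (Finset (Tup k n)) := Q.powerset.filter fun Z =>
    (∀ x ∈ Z, ∀ i ∈ I, x i = a i) ∧ Spread r 2 Z I ∧ τ * n ^ k * r ^ I.card ≤ Z.card with hS
  rcases S.eq_empty_or_nonempty with he | hne
  · have : ∀ G : Finset (Sym2 (Vtx k n)), JProp r τ G Q I a := by
      intro G Z hZQ h1 h2 h3
      exfalso
      have : Z ∈ S := by simp only [hS, Finset.mem_filter, Finset.mem_powerset]; exact ⟨hZQ, h1, h2, h3⟩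
      rw [he] at this
      simp at this
    simp only [this, not_true_eq_false, if_false]
    have h0 : EV (potEdges k n) p (fun _ => (0:ℝ)) = 0 := by simp [EV]
    rw [h0]
    positivity
  · obtain ⟨Z, hZ, hmax⟩ := Finset.exists_max_image S Finset.card hne
    simp only [hS, Finset.mem_filter, Finset.mem_powerset] at hZ
    obtain ⟨hZQ, h1, h2, h3⟩ := hZ
    refine (EV_mono hp0.le hp1 ?_).trans (fail_prob hk hn hp0 hp1 hr hτ hm hky hZQ h1 h2 h3)
    intro G hG
    by_cases hc : CliqueOn G I a ∧ ¬∃ x ∈ Z, ∃ A, Disjoint A I ∧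
        PGood r Q (I ∪ A) x (Z.card / 2 * r ^ A.card) ∧ CliqueOn G (I ∪ A) x
    · rw [if_pos hc]
      split_ifs <;> norm_num
    · have : JProp r τ G Q I a := by
        intro Z' hZ'Q h1' h2' h3' hcl
        have hle := hmax Z' (by
          simp only [hS, Finset.mem_filter, Finset.mem_powerset]; exact ⟨hZ'Q, h1', h2', h3'⟩)
        push Not at hc
        obtain ⟨x, -, A, hA, hP, hcx⟩ := hc hcl
        refine ⟨x, A, hA, hP.mono ?_, hcx⟩
        gcongr
      rw [if_neg hc, if_neg (not_not.2 this)]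

/-- The tuple sets reachable by `j` cuts by functions of the family `F`. -/
noncomputable def cuts {k n : ℕ} (F : Finset (Tup k n → Bool)) : ℕ → Finset (Finset (Tup k n))
  | 0 => {univ}
  | j + 1 => ((cuts F j ×ˢ F) ×ˢ (univ : Finset Bool)).image
      fun q => q.1.1.filter fun t => q.1.2 t = q.2

lemma cuts_card {k n : ℕ} (F : Finset (Tup k n → Bool)) (j : ℕ) :
    (cuts F j).card ≤ (2 * F.card) ^ j := by
  induction j with
  | zero => simp [cuts]
  | succ j ih =>
    rw [cuts]
    refine Finset.card_image_le.trans ?_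
    rw [Finset.card_product, Finset.card_product, pow_succ]
    simp only [Finset.card_univ, Fintype.card_bool]
    nlinarith [Nat.mul_le_mul_right (F.card * 2) ih]

lemma cuts_succ {k n : ℕ} {F : Finset (Tup k n → Bool)} {j : ℕ} {Q : Finset (Tup k n)}
    (hQ : Q ∈ cuts F j) {f : Tup k n → Bool} (hf : f ∈ F) (s : Bool) :
    Q.filter (fun t => f t = s) ∈ cuts F (j + 1) := by
  rw [cuts, Finset.mem_image]
  exact ⟨((Q, f), s), by simp [hQ, hf], rfl⟩

open Classical in
theorem union_bound {k n m : ℕ} {p r τ : ℝ} (hk : 0 < k) (hn : 0 < n) (hp0 : 0 < p)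
    (hp1 : p ≤ 1) (hr : 0 < r) (hτ : 0 < τ)
    (hm : ∀ l : ℕ, τ / 2 * ((n : ℝ) * r) ^ l ≤ 1 → l ≤ m)
    (hky : k * (r * (p⁻¹) ^ m) ≤ 1) (F : Finset (Tup k n → Bool)) (hF : 1 ≤ F.card) (h : ℕ)
    (P : Finset (Sym2 (Vtx k n)) → Prop)
    (hP : ∀ G ⊆ potEdges k n, (∀ j ≤ h, ∀ Q ∈ cuts F j, ∀ I a, JProp r τ G Q I a) → P G) :
    1 - (h + 1) * (2 * F.card) ^ h * (2 ^ k * n ^ k) *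
      Real.exp (-(1 / (2 * (8 * (k * (r * (p⁻¹) ^ m)))))) ≤ probG k n p P := by
  set X : Finset ((ℕ × Finset (Tup k n)) × (Finset (Fin k) × Tup k n)) :=
    ((range (h + 1)) ×ˢ ((range (h + 1)).biUnion fun j => cuts F j)) ×ˢ univ with hX
  set Y : Finset (Finset (Tup k n) × (Finset (Fin k) × Tup k n)) :=
    ((range (h + 1)).biUnion fun j => cuts F j) ×ˢ univ with hY
  have hprob : probG k n p P = EV (potEdges k n) p (fun G => if P G then 1 else 0) := by
    unfold probG EV
    refine Finset.sum_congr rfl fun G _ => ?_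
    simp [mul_ite]
  have hYc : (Y.card : ℝ) ≤ (h + 1) * (2 * F.card) ^ h * (2 ^ k * n ^ k) := by
    have h1 : ((range (h + 1)).biUnion fun j => cuts F j).card ≤ (h + 1) * (2 * F.card) ^ h := by
      refine Finset.card_biUnion_le.trans ?_
      refine (Finset.sum_le_card_nsmul _ _ ((2 * F.card) ^ h) ?_).trans (by simp)
      intro j hj
      refine (cuts_card F j).trans (Nat.pow_le_pow_right (by omega) ?_)
      have := Finset.mem_range.1 hj
      omega
    have h2 : Y.card ≤ (h + 1) * (2 * F.card) ^ h * (2 ^ k * n ^ k) := by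
      rw [hY, Finset.card_product, Finset.card_univ, Fintype.card_prod, Fintype.card_finset,
        Fintype.card_fun, Fintype.card_fin, Fintype.card_fin]
      exact Nat.mul_le_mul_right _ h1
    exact_mod_cast h2
  have hb : EV (potEdges k n) p (fun G => ∑ y ∈ Y,
      if ¬ JProp r τ G y.1 y.2.1 y.2.2 then 1 else 0) ≤ (h + 1) * (2 * F.card) ^ h * (2 ^ k * n ^ k) *
      Real.exp (-(1 / (2 * (8 * (k * (r * (p⁻¹) ^ m)))))) := by
    rw [EV_sum]
    refine (Finset.sum_le_card_nsmul _ _ _ fun y _ =>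
      JProp_fail hk hn hp0 hp1 hr hτ hm hky y.1 y.2.1 y.2.2).trans ?_
    rw [nsmul_eq_mul]
    gcongr
  have hmain : EV (potEdges k n) p (fun G => 1 - ∑ y ∈ Y,
      if ¬ JProp r τ G y.1 y.2.1 y.2.2 then 1 else 0) ≤ probG k n p P := by
    rw [hprob]
    refine EV_mono hp0.le hp1 fun G hG => ?_
    by_cases hall : ∀ y ∈ Y, JProp r τ G y.1 y.2.1 y.2.2
    · rw [if_pos]
      · have : (0:ℝ) ≤ ∑ y ∈ Y, if ¬ JProp r τ G y.1 y.2.1 y.2.2 then 1 else 0 :=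
          Finset.sum_nonneg fun y _ => by split_ifs <;> norm_num
        linarith
      · refine hP G hG fun j hj Q hQ I a => hall (Q, I, a) ?_
        rw [hY, Finset.mem_product]
        exact ⟨Finset.mem_biUnion.2 ⟨j, by simp; omega, hQ⟩, Finset.mem_univ _⟩
    · push Not at hall
      obtain ⟨y, hy, hyJ⟩ := hall
      have h1 : (1:ℝ) ≤ ∑ y ∈ Y, if ¬ JProp r τ G y.1 y.2.1 y.2.2 then 1 else 0 := by
        have := Finset.single_le_sum (f := fun y : Finset (Tup k n) × (Finset (Fin k) × Tup k n) =>
          if ¬ JProp r τ G y.1 y.2.1 y.2.2 then (1:ℝ) else 0)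
          (fun y _ => by split_ifs <;> norm_num) hy
        simp only [hyJ, not_false_eq_true, if_true] at this
        exact this
      have h2 : (0:ℝ) ≤ if P G then 1 else 0 := by split_ifs <;> norm_num
      linarith
  rw [EV_sub, EV_one] at hmain
  linarith

open Classical in
/-- Number of lines of the proof that are not cut off by the pruned lines `P`. -/
noncomputable def wt {N : ℕ} (P : Set (BFunc N)) : SemProof N → ℕ
  | .leaf f => if f ∈ P then 0 else 1
  | .node1 f s => if f ∈ P then 0 else wt P s + 1
  | .node2 f s t => if f ∈ P then 0 else wt P s + wt P t + 1

lemma wt_empty {N : ℕ} (T : SemProof N) : wt ∅ T = T.length := by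
  induction T with
  | leaf f => simp [wt, SemProof.length]
  | node1 f s ih => simp [wt, SemProof.length, ih]
  | node2 f s t ih1 ih2 => simp [wt, SemProof.length, ih1, ih2]

lemma wt_root {N : ℕ} {P : Set (BFunc N)} {T : SemProof N} (h : T.root ∈ P) : wt P T = 0 := by
  cases T <;> simp only [SemProof.root] at h <;> simp [wt, h]

lemma root_of_wt {N : ℕ} {P : Set (BFunc N)} {T : SemProof N} (h : wt P T = 0) : T.root ∈ P := by
  by_contra hc
  cases T <;> simp only [SemProof.root] at hc <;> simp [wt, hc] at h

lemma wt_mono {N : ℕ} (P : Set (BFunc N)) (g : BFunc N) (T : SemProof N) :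
    wt (insert g P) T ≤ wt P T := by
  induction T with
  | leaf f =>
    by_cases h : f ∈ P
    · simp [wt, h]
    · by_cases h2 : f = g <;> simp [wt, h, h2]
  | node1 f s ih =>
    by_cases h : f ∈ P
    · simp [wt, h]
    · by_cases h2 : f ∈ insert g P
      · simp only [wt, if_pos h2]; omega
      · simp only [wt, if_neg h2, if_neg h]; omega
  | node2 f s t ih1 ih2 =>
    by_cases h : f ∈ P
    · simp [wt, h]
    · by_cases h2 : f ∈ insert g P
      · simp only [wt, if_pos h2]; omega
      · simp only [wt, if_neg h2, if_neg h]; omega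

lemma wt_find {N : ℕ} {F : Set (BFunc N)} {A : Finset (Clause N)} (P : Set (BFunc N)) (b : ℕ)
    (hb : 1 ≤ b) (T : SemProof N) (hT : T.Valid F A) (hw : b < wt P T) :
    ∃ U : SemProof N, U.Valid F A ∧ wt P U ≤ b ∧ b ≤ 2 * wt P U ∧
      wt (insert U.root P) T + wt P U ≤ wt P T := by
  induction T with
  | leaf f =>
    simp only [wt] at hw
    split_ifs at hw <;> omega
  | node1 f s ih =>
    by_cases hf : f ∈ P
    · simp [wt, hf] at hw
    have hfw : wt P (.node1 f s) = wt P s + 1 := by simp [wt, hf]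
    have hfw' : ∀ g, wt (insert g P) (.node1 f s) ≤ wt (insert g P) s + 1 := by
      intro g
      simp only [wt]
      split_ifs <;> omega
    rw [hfw] at hw ⊢
    by_cases hs : wt P s ≤ b
    · refine ⟨s, hT.2, hs, by omega, ?_⟩
      have := hfw' s.root
      have h0 : wt (insert s.root P) s = 0 := wt_root (by simp)
      omega
    · obtain ⟨U, h1, h2, h3, h4⟩ := ih hT.2 (by omega)
      refine ⟨U, h1, h2, h3, ?_⟩
      have := hfw' U.root
      omega
  | node2 f s t ih1 ih2 =>
    by_cases hf : f ∈ P
    · simp [wt, hf] at hw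
    have hfw : wt P (.node2 f s t) = wt P s + wt P t + 1 := by simp [wt, hf]
    have hfw' : ∀ g, wt (insert g P) (.node2 f s t) ≤
        wt (insert g P) s + wt (insert g P) t + 1 := by
      intro g
      simp only [wt]
      split_ifs <;> omega
    rw [hfw] at hw ⊢
    by_cases hst : wt P t ≤ wt P s
    · by_cases hs : wt P s ≤ b
      · refine ⟨s, hT.2.1, hs, by omega, ?_⟩
        have := hfw' s.root
        have h0 : wt (insert s.root P) s = 0 := wt_root (by simp)
        have := wt_mono P s.root t
        omega
      · obtain ⟨U, h1, h2, h3, h4⟩ := ih1 hT.2.1 (by omega)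
        refine ⟨U, h1, h2, h3, ?_⟩
        have := hfw' U.root
        have := wt_mono P U.root t
        omega
    · by_cases hs : wt P t ≤ b
      · refine ⟨t, hT.2.2, hs, by omega, ?_⟩
        have := hfw' t.root
        have h0 : wt (insert t.root P) t = 0 := wt_root (by simp)
        have := wt_mono P t.root s
        omega
      · obtain ⟨U, h1, h2, h3, h4⟩ := ih2 hT.2.2 (by omega)
        refine ⟨U, h1, h2, h3, ?_⟩
        have := hfw' U.root
        have := wt_mono P U.root s
        omega

lemma valid_root {N : ℕ} {F : Set (BFunc N)} {A : Finset (Clause N)} {T : SemProof N}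
    (hT : T.Valid F A) : (∃ c ∈ A, T.root = falsInd c) ∨ T.root ∈ F := by
  cases T with
  | leaf f => exact Or.inl hT
  | node1 f s => exact hT.1.imp id And.left
  | node2 f s t => exact hT.1.imp id And.left

/-- A nonempty set that is spread above a clique is not ruled out by a missing edge. -/
lemma not_ruled_out {k n : ℕ} {r : ℝ} (hr1 : r < 1) {G : Finset (Sym2 (Vtx k n))}
    {Z : Finset (Tup k n)} {I : Finset (Fin k)} {a : Tup k n} (hne : Z.Nonempty)
    (hZa : ∀ x ∈ Z, ∀ i ∈ I, x i = a i) (hsp : Spread r 1 Z I) (hcl : CliqueOn G I a)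
    {i j : Fin k} {u v : Fin n} (hij : i ≠ j) (hG : s((i, u), (j, v)) ∉ G)
    (hi : ∀ x ∈ Z, x i = u) (hj : ∀ x ∈ Z, x j = v) : False := by
  obtain ⟨z, hz⟩ := hne
  have hmem : ∀ l : Fin k, (∀ x ∈ Z, x l = z l) → l ∈ I := by
    intro l hl
    by_contra hlI
    have h := hsp {l} (by simpa using hlI) z
    have : agr Z {l} z = Z := by
      ext x
      rw [mem_agr]
      constructor
      · exact fun h => h.1
      · intro hx
        refine ⟨hx, fun i hi => ?_⟩
        rw [Finset.mem_singleton.1 hi]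
        exact hl x hx
    rw [this] at h
    simp only [card_singleton, pow_one, one_mul] at h
    have hpos : (0:ℝ) < Z.card := by exact_mod_cast Finset.card_pos.2 ⟨z, hz⟩
    nlinarith
  have hiI := hmem i fun x hx => by rw [hi x hx, hi z hz]
  have hjI := hmem j fun x hx => by rw [hj x hx, hj z hz]
  have := hcl i hiI j hjI hij
  apply hG
  rw [tupEdge, ← hZa z hz i hiI, ← hZa z hz j hjI, hi z hz, hj z hz] at this
  exact this

lemma descent_base {k n N : ℕ} {r M : ℝ} (hr1 : r < 1) (hM : 0 < M)
    {G : Finset (Sym2 (Vtx k n))} {F : Set (BFunc N)} {A : Finset (Clause N)}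
    (enc : Tup k n → (Fin N → Bool))
    (hax : ∀ c ∈ A, ∃ (i j : Fin k) (u v : Fin n), i ≠ j ∧ s((i, u), (j, v)) ∉ G ∧
      ∀ t, falsInd c (enc t) = true → t i = u ∧ t j = v)
    {T : SemProof N} {P : Set (BFunc N)} {Q : Finset (Tup k n)} {I : Finset (Fin k)}
    {a : Tup k n} (hT : T.Valid F A) (hw : wt P T ≤ 1)
    (hQT : ∀ t ∈ Q, T.root (enc t) = true) (hQP : ∀ t ∈ Q, ∀ f ∈ P, f (enc t) = false)
    (hPG : PGood r Q I a M) (hcl : CliqueOn G I a) : False := by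
  obtain ⟨Z, hZQ, hZa, hsp, hZM⟩ := hPG
  have hne : Z.Nonempty := by
    rw [← Finset.card_pos]
    exact_mod_cast hM.trans_le hZM
  have hrootP : T.root ∉ P := by
    intro hP
    obtain ⟨z, hz⟩ := hne
    have h1 := hQP z (hZQ hz) _ hP
    rw [hQT z (hZQ hz)] at h1
    cases h1
  have hclause : (∃ c ∈ A, T.root = falsInd c) → False := by
    rintro ⟨c, hc, hroot⟩
    obtain ⟨i, j, u, v, hij, hG, hcov⟩ := hax c hc
    have h1 : ∀ x ∈ Z, x i = u ∧ x j = v := fun x hx => hcov x (by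
      rw [← hroot]; exact hQT x (hZQ hx))
    exact not_ruled_out hr1 hne hZa hsp hcl hij hG (fun x hx => (h1 x hx).1) (fun x hx => (h1 x hx).2)
  obtain ⟨z, hz⟩ := hne
  have hz1 := hQT z (hZQ hz)
  cases T with
  | leaf f => exact hclause hT
  | node1 f s =>
    simp only [SemProof.root] at hrootP hclause hz1
    rcases hT.1 with hc | ⟨-, himp⟩
    · exact hclause hc
    · have hs : wt P s = 0 := by
        simp only [wt, if_neg hrootP] at hw
        omega
      have h1 := hQP z (hZQ hz) _ (root_of_wt hs)
      rw [himp _ hz1] at h1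
      cases h1
  | node2 f s t =>
    simp only [SemProof.root] at hrootP hclause hz1
    rcases hT.1 with hc | ⟨-, himp⟩
    · exact hclause hc
    · have hs : wt P s = 0 ∧ wt P t = 0 := by
        simp only [wt, if_neg hrootP] at hw
        omega
      rcases himp _ hz1 with h2 | h2
      · have h1 := hQP z (hZQ hz) _ (root_of_wt hs.1)
        rw [h2] at h1
        cases h1
      · have h1 := hQP z (hZQ hz) _ (root_of_wt hs.2)
        rw [h2] at h1
        cases h1

lemma descent_step {k n : ℕ} {r τ : ℝ} (hr : 0 < r) {G : Finset (Sym2 (Vtx k n))} {h j : ℕ}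
    (hτ : τ = 1 / 2 * (1 / 4) ^ h) (hjh : j ≤ h) {Q : Finset (Tup k n)} {I : Finset (Fin k)}
    {a : Tup k n} {f : Tup k n → Bool}
    (hJ : ∀ b : Bool, JProp r τ G (Q.filter fun t => f t = b) I a)
    (hPG : PGood r Q I a ((1 / 4) ^ j * n ^ k * r ^ I.card)) (hcl : CliqueOn G I a) :
    ∃ (b : Bool) (I' : Finset (Fin k)) (a' : Tup k n),
      PGood r (Q.filter fun t => f t = b) I' a' ((1 / 4) ^ (j + 1) * n ^ k * r ^ I'.card) ∧
      CliqueOn G I' a' := by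
  obtain ⟨Z, hZQ, hZa, hsp, hZM⟩ := hPG
  have hsum : (Z.filter fun t => f t = true).card + (Z.filter fun t => f t = false).card =
      Z.card := by
    have := Finset.card_filter_add_card_filter_not (s := Z) (fun t => f t = true)
    simpa using this
  obtain ⟨b, hb⟩ : ∃ b : Bool, Z.card ≤ 2 * (Z.filter fun t => f t = b).card := by
    by_cases hc : Z.card ≤ 2 * (Z.filter fun t => f t = true).card
    · exact ⟨true, hc⟩
    · exact ⟨false, by omega⟩
  set Z' := Z.filter fun t => f t = b with hZ'
  have hb' : (Z.card : ℝ) ≤ 2 * Z'.card := by exact_mod_cast hb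
  have hZ'Z : Z' ⊆ Z := Finset.filter_subset _ _
  obtain ⟨x, A, hA, hP, hclx⟩ := hJ b Z' (Finset.filter_subset_filter _ hZQ)
    (fun x hx => hZa x (hZ'Z hx)) (by
      intro A hA c
      have h1 : ((agr Z' A c).card : ℝ) ≤ (agr Z A c).card := by
        have : agr Z' A c ⊆ agr Z A c := fun y hy => by
          rw [mem_agr] at hy ⊢
          exact ⟨hZ'Z hy.1, hy.2⟩
        exact_mod_cast Finset.card_le_card this
      refine h1.trans ((hsp A hA c).trans ?_)
      have : 0 < r ^ A.card := by positivity
      nlinarith) (by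
      have h1 : ((1:ℝ) / 4) ^ h ≤ (1 / 4) ^ j := pow_le_pow_of_le_one (by norm_num) (by norm_num) hjh
      have h2 : (0:ℝ) ≤ n ^ k * r ^ I.card := by positivity
      have h3 := mul_le_mul_of_nonneg_right h1 h2
      rw [hτ]
      nlinarith) hcl
  refine ⟨b, I ∪ A, x, hP.mono ?_, hclx⟩
  rw [Finset.card_union_of_disjoint hA.symm, pow_add _ _ A.card, pow_succ]
  have : 0 < r ^ A.card := by positivity
  have h5 : (1 / 4) ^ j * 1/4 * n ^ k * r ^ I.card ≤ (Z'.card : ℝ) / 2 := by linarith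
  have := mul_le_mul_of_nonneg_right h5 this.le
  linarith

theorem descent {k n N : ℕ} {r τ : ℝ} (hr : 0 < r) (hr1 : r < 1) (hn : 0 < n)
    {G : Finset (Sym2 (Vtx k n))} {F : Set (BFunc N)} {A : Finset (Clause N)}
    (enc : Tup k n → (Fin N → Bool))
    (hax : ∀ c ∈ A, ∃ (i j : Fin k) (u v : Fin n), i ≠ j ∧ s((i, u), (j, v)) ∉ G ∧
      ∀ t, falsInd c (enc t) = true → t i = u ∧ t j = v)
    (F' : Finset (Tup k n → Bool)) (hF : ∀ f ∈ F, (fun t => f (enc t)) ∈ F')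
    (hF2 : ∀ c : Clause N, (fun t => falsInd c (enc t)) ∈ F') (h : ℕ)
    (hτ : τ = 1 / 2 * (1 / 4) ^ h)
    (hJ : ∀ j ≤ h, ∀ Q ∈ cuts F' j, ∀ I a, JProp r τ G Q I a) :
    ∀ (e j : ℕ) (T : SemProof N) (P : Set (BFunc N)) (Q : Finset (Tup k n)) (I : Finset (Fin k))
      (a : Tup k n), j + e = h → T.Valid F A → (wt P T : ℝ) ≤ (5 / 4) ^ e → Q ∈ cuts F' j →
      (∀ t ∈ Q, T.root (enc t) = true) → (∀ t ∈ Q, ∀ f ∈ P, f (enc t) = false) →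
      PGood r Q I a ((1 / 4) ^ j * n ^ k * r ^ I.card) → CliqueOn G I a → False := by
  intro e
  have hpos : ∀ (j : ℕ) (I : Finset (Fin k)), (0:ℝ) < (1 / 4) ^ j * n ^ k * r ^ I.card := by
    intro j I
    positivity
  induction e with
  | zero =>
    intro j T P Q I a hje hT hw hQ hQT hQP hPG hcl
    rw [pow_zero] at hw
    exact descent_base hr1 (hpos _ _) enc hax hT (by exact_mod_cast hw) hQT hQP hPG hcl
  | succ e ih =>
    intro j T P Q I a hje hT hw hQ hQT hQP hPG hcl
    by_cases hw1 : wt P T ≤ 1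
    · exact descent_base hr1 (hpos _ _) enc hax hT hw1 hQT hQP hPG hcl
    obtain ⟨U, hU, h1, h2, h3⟩ := wt_find P (wt P T / 2) (by omega) T hT (by omega)
    have hUF : (fun t => U.root (enc t)) ∈ F' := by
      rcases valid_root hU with ⟨c, -, hc⟩ | hc
      · rw [hc]; exact hF2 c
      · exact hF _ hc
    obtain ⟨b, I', a', hP', hcl'⟩ := descent_step hr hτ (j := j) (by omega)
      (f := fun t => U.root (enc t))
      (fun b => hJ (j + 1) (by omega) _ (cuts_succ hQ hUF b) I a) hPG hcl
    rw [pow_succ] at hw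
    cases b with
    | true =>
      refine ih (j + 1) U P _ I' a' (by omega) hU ?_ (cuts_succ hQ hUF true) ?_ ?_ hP' hcl'
      · have : 5 * wt P U ≤ 4 * wt P T := by omega
        have : (5:ℝ) * wt P U ≤ 4 * wt P T := by exact_mod_cast this
        linarith
      · intro t ht
        exact (Finset.mem_filter.1 ht).2
      · intro t ht
        exact hQP t (Finset.mem_filter.1 ht).1
    | false =>
      refine ih (j + 1) T (insert U.root P) _ I' a' (by omega) hT ?_ (cuts_succ hQ hUF false)
        ?_ ?_ hP' hcl'
      · have : 5 * wt (insert U.root P) T ≤ 4 * wt P T := by omega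
        have : (5:ℝ) * wt (insert U.root P) T ≤ 4 * wt P T := by exact_mod_cast this
        linarith
      · intro t ht
        exact hQT t (Finset.mem_filter.1 ht).1
      · intro t ht f hf
        rcases Set.mem_insert_iff.1 hf with rfl | hf
        · exact (Finset.mem_filter.1 ht).2
        · exact hQP t (Finset.mem_filter.1 ht).1 f hf

/-- The binary encoding of a tuple. -/
def encT {k n : ℕ} (t : Tup k n) : Fin (k * Nat.clog 2 n) → Bool :=
  fun w => ((t (finProdFinEquiv.symm w).1 : Fin n) : ℕ).testBit (finProdFinEquiv.symm w).2

lemma fin_eq_of_bits {n : ℕ} (u v : Fin n)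
    (h : ∀ b : Fin (Nat.clog 2 n), (u : ℕ).testBit b = (v : ℕ).testBit b) : u = v := by
  apply Fin.ext
  apply Nat.eq_of_testBit_eq
  intro i
  by_cases hi : i < Nat.clog 2 n
  · exact h ⟨i, hi⟩
  · have h1 : n ≤ 2 ^ Nat.clog 2 n := Nat.le_pow_clog (by norm_num) n
    have h2 : 2 ^ Nat.clog 2 n ≤ 2 ^ i := Nat.pow_le_pow_right (by norm_num) (by omega)
    rw [Nat.testBit_lt_two_pow (by omega), Nat.testBit_lt_two_pow (by omega)]

lemma bclique_clause_covers {k n : ℕ} {G : Finset (Sym2 (Vtx k n))} :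
    ∀ c ∈ bcliqueB k n G, ∃ (i j : Fin k) (u v : Fin n), i ≠ j ∧ s((i, u), (j, v)) ∉ G ∧
      ∀ t : Tup k n, falsInd c (encT t) = true → t i = u ∧ t j = v := by
  intro c hc
  classical
  rw [bcliqueB, Finset.mem_image] at hc
  obtain ⟨⟨⟨i, u⟩, ⟨j, v⟩⟩, hq, rfl⟩ := hc
  simp only [Finset.mem_filter, Finset.mem_univ, true_and] at hq
  refine ⟨i, j, u, v, hq.1, hq.2, fun t ht => ?_⟩
  simp only [falsInd, decide_eq_true_eq] at ht
  constructor
  · apply fin_eq_of_bits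
    intro b
    have := ht (finProdFinEquiv (i, b)) (!((u : ℕ).testBit b)) (by simp)
    simpa [encT] using this
  · apply fin_eq_of_bits
    intro b
    have := ht (finProdFinEquiv (j, b)) (!((v : ℕ).testBit b)) (by simp [hq.1.symm])
    simpa [encT] using this

theorem length_lower {k n : ℕ} {r τ : ℝ} (hr : 0 < r) (hr1 : r < 1) (hn : 0 < n)
    (hnr : 1 ≤ n * r)
    {G : Finset (Sym2 (Vtx k n))} {F : Set (BFunc (k * Nat.clog 2 n))}
    (F' : Finset (Tup k n → Bool)) (hF : ∀ f ∈ F, (fun t => f (encT t)) ∈ F')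
    (hF2 : ∀ c : Clause (k * Nat.clog 2 n), (fun t => falsInd c (encT t)) ∈ F') (h : ℕ)
    (hτ : τ = 1 / 2 * (1 / 4) ^ h)
    (hJ : ∀ j ≤ h, ∀ Q ∈ cuts F' j, ∀ I a, JProp r τ G Q I a)
    (π : SemProof (k * Nat.clog 2 n)) (hπ : IsRefutation F (bcliqueB k n G) π) :
    (5 / 4 : ℝ) ^ h ≤ π.length := by
  by_contra hlt
  push Not at hlt
  refine descent hr hr1 hn encT bclique_clause_covers F' hF hF2 h hτ hJ h 0 π ∅ univ ∅ (fun _ => ⟨0, hn⟩)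
    (by omega) hπ.1 (by rw [wt_empty]; exact hlt.le) (by simp [cuts]) (fun t _ => hπ.2 _)
    (by simp) ⟨univ, Finset.Subset.refl _, by simp, ?_, by simp⟩ (by intro i hi; simp at hi)
  intro A _ b
  have h1 := card_agr_univ A b
  have h2 : ((agr univ A b).card : ℝ) * n ^ A.card = n ^ k := by exact_mod_cast h1
  have h3 : (1:ℝ) ≤ (n * r) ^ A.card := one_le_pow₀ hnr
  rw [mul_pow] at h3
  have h4 : (0:ℝ) < n ^ A.card := by positivity
  simp only [Finset.card_univ, Fintype.card_fun, Fintype.card_fin, Nat.cast_pow]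
  rw [one_mul, ← h2]
  have h5 : (0:ℝ) ≤ (agr univ A b).card := by positivity
  nlinarith [mul_le_mul_of_nonneg_left h3 h5]

/-- The sets of at most `d` variables. -/
def monos (N d : ℕ) : Finset (Finset (Fin N)) := univ.filter fun S => S.card ≤ d

open Classical in
/-- The lines of `Th(d)` as a family of sets. -/
noncomputable def thFam (N d : ℕ) : Finset (Finset (Fin N → Bool)) :=
  univ.filter fun s => ∃ f ∈ ThLines N d, s = univ.filter fun α => f α = true

lemma thFam_shatters {N d : ℕ} {s : Finset (Fin N → Bool)} (hs : (thFam N d).Shatters s) :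
    s.card ≤ (monos N d).card := by
  classical
  by_contra hlt
  push Not at hlt
  set v : s → (monos N d → ℚ) := fun x S => ∏ i ∈ S.1, (if x.1 i then 1 else 0) with hv
  have hdep : ¬ LinearIndependent ℚ v := by
    intro hli
    have := hli.fintype_card_le_finrank
    simp at this
    omega
  rw [Fintype.not_linearIndependent_iff] at hdep
  have key : ∃ g : s → ℚ, ∑ i, g i • v i = 0 ∧ ∃ i, 0 < g i := by
    obtain ⟨g, hg, i, hi⟩ := hdep
    rcases lt_or_gt_of_ne hi with h | h
    · exact ⟨-g, by simp only [Pi.neg_apply, neg_smul, Finset.sum_neg_distrib, hg, neg_zero], i, by simpa using h⟩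
    · exact ⟨g, hg, i, h⟩
  obtain ⟨g, hg, x0, hx0⟩ := key
  obtain ⟨u, hu, hut⟩ := hs (t := s.filter fun x => ∃ h : x ∈ s, 0 < g ⟨x, h⟩)
    (Finset.filter_subset _ _)
  simp only [thFam, Finset.mem_filter, Finset.mem_univ, true_and] at hu
  obtain ⟨f, ⟨coeff, hc0, hcf⟩, rfl⟩ := hu
  set p : (Fin N → Bool) → ℤ := fun α =>
    ∑ S : Finset (Fin N), coeff S * ∏ i ∈ S, (if α i then 1 else 0) with hp
  have hsign : ∀ x : s, 0 < g x ↔ p x.1 < 0 := by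
    intro x
    have h1 := Finset.ext_iff.1 hut x.1
    simp only [Finset.mem_inter, Finset.mem_filter, Finset.mem_univ, true_and, x.2] at h1
    rw [hcf] at h1
    simp only [Bool.not_eq_true', decide_eq_false_iff_not, not_le, exists_const,
      Subtype.coe_eta] at h1
    rw [← h1]
  have hval : ∀ x : s, (p x.1 : ℚ) = ∑ S : monos N d, (coeff S.1 : ℚ) * v x S := by
    intro x
    rw [Finset.sum_coe_sort (monos N d) (fun S => (coeff S : ℚ) * ∏ i ∈ S, (if x.1 i then 1 else 0))]
    simp only [hp]
    push_cast
    symm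
    refine Finset.sum_subset (Finset.subset_univ _) fun S _ hS => ?_
    simp only [monos, Finset.mem_filter, Finset.mem_univ, true_and, not_le] at hS
    rw [hc0 S hS]
    simp
  have hzero : ∑ x : s, g x * (p x.1 : ℚ) = 0 := by
    simp only [hval, Finset.mul_sum]
    rw [Finset.sum_comm]
    refine Finset.sum_eq_zero fun S _ => ?_
    have := congrFun hg S
    simp only [Finset.sum_apply, Pi.smul_apply, smul_eq_mul, Pi.zero_apply] at this
    calc _ = (coeff S.1 : ℚ) * ∑ x : s, g x * v x S := by
          rw [Finset.mul_sum]
          exact Finset.sum_congr rfl fun x _ => by ring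
      _ = 0 := by rw [this, mul_zero]
  have hneg : ∑ x : s, g x * (p x.1 : ℚ) < 0 := by
    refine Finset.sum_neg' (fun x _ => ?_) ⟨x0, Finset.mem_univ _, ?_⟩
    · by_cases h : 0 < g x
      · have : (p x.1 : ℚ) < 0 := by exact_mod_cast (hsign x).1 h
        nlinarith
      · have h2 : ¬ p x.1 < 0 := fun h' => h ((hsign x).2 h')
        have : (0:ℚ) ≤ p x.1 := by exact_mod_cast not_lt.1 h2
        nlinarith
    · have : (p x0.1 : ℚ) < 0 := by exact_mod_cast (hsign x0).1 hx0
      nlinarith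
  linarith

lemma sum_choose_le (K M : ℕ) : ∑ i ∈ Iic M, K.choose i ≤ (K + 1) ^ M := by
  rw [add_pow, Nat.range_succ_eq_Iic]
  refine Finset.sum_le_sum fun i hi => ?_
  have h1 : 1 ≤ M.choose i := Nat.choose_pos (by simpa using hi)
  have h2 := Nat.choose_le_pow K i
  simp only [one_pow, mul_one, Nat.cast_id]
  nlinarith

lemma thFam_card (N d : ℕ) : (thFam N d).card ≤ (2 ^ N + 1) ^ (monos N d).card := by
  classical
  refine (Finset.card_le_card_shatterer _).trans (Finset.card_shatterer_le_sum_vcDim.trans ?_)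
  refine (sum_choose_le _ _).trans ?_
  simp only [Fintype.card_fun, Fintype.card_bool, Fintype.card_fin]
  refine Nat.pow_le_pow_right (Nat.succ_pos _) ?_
  rw [Finset.vcDim]
  exact Finset.sup_le fun s hs => thFam_shatters (Finset.mem_shatterer.1 hs)

lemma monos_card (N d : ℕ) {y : ℝ} (hy : 0 < y) (hy1 : y ≤ 1) :
    ((monos N d).card : ℝ) ≤ (y⁻¹) ^ d * (1 + y) ^ N := by
  have h1 : ∑ S : Finset (Fin N), y ^ S.card = (1 + y) ^ N := by
    have := Finset.sum_pow_mul_eq_add_pow y 1 (univ : Finset (Fin N))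
    simp only [one_pow, mul_one, Finset.powerset_univ, Finset.card_univ, Fintype.card_fin] at this
    rw [this, add_comm]
  rw [← h1, Finset.card_eq_sum_ones, Finset.mul_sum]
  push_cast
  refine (Finset.sum_le_sum (g := fun S => (y⁻¹) ^ d * y ^ S.card) fun S hS => ?_).trans
    (Finset.sum_le_univ_sum_of_nonneg fun S => by positivity)
  simp only [monos, Finset.mem_filter, Finset.mem_univ, true_and] at hS
  have h2 : y ^ d ≤ y ^ S.card := pow_le_pow_of_le_one hy.le hy1 hS
  calc (1:ℝ) = (y⁻¹) ^ d * y ^ d := by rw [← mul_pow, inv_mul_cancel₀ hy.ne', one_pow]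
    _ ≤ _ := by gcongr

/-- There is a small family containing the restrictions of all lines. -/
lemma exists_family {k n N d : ℕ} (enc : Tup k n → (Fin N → Bool)) :
    ∃ F' : Finset (Tup k n → Bool), (∀ f ∈ ThLines N d, (fun t => f (enc t)) ∈ F') ∧
      (∀ c : Clause N, (fun t => falsInd c (enc t)) ∈ F') ∧ 1 ≤ F'.card ∧
      F'.card ≤ (2 ^ N + 1) ^ (monos N d).card + 3 ^ N := by
  classical
  refine ⟨(thFam N d).image (fun s t => decide (enc t ∈ s)) ∪
    (univ : Finset (Clause N)).image (fun c t => falsInd c (enc t)), ?_, ?_, ?_, ?_⟩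
  · intro f hf
    refine Finset.mem_union_left _ (Finset.mem_image.2 ⟨univ.filter fun α => f α = true, ?_, ?_⟩)
    · simp only [thFam, Finset.mem_filter, Finset.mem_univ, true_and]
      exact ⟨f, hf, rfl⟩
    · funext t
      simp
  · intro c
    exact Finset.mem_union_right _ (Finset.mem_image.2 ⟨c, Finset.mem_univ _, rfl⟩)
  · refine Finset.card_pos.2 ⟨_, Finset.mem_union_right _
      (Finset.mem_image.2 ⟨fun _ => none, Finset.mem_univ _, rfl⟩)⟩
  · refine (Finset.card_union_le _ _).trans (Nat.add_le_add
      (Finset.card_image_le.trans (thFam_card N d)) (Finset.card_image_le.trans ?_))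
    simp [Finset.card_univ]

lemma monos_bound {N : ℕ} {L C : ℝ} (hL : 2000 ≤ L)
    (hE : C / 0.03 ≤ L ^ (0.1 : ℝ)) (hN : (N : ℝ) ≤ C * L ^ 2) :
    ((monos N ⌊L / (2 * Real.logb 2 L)⌋₊).card : ℝ) ≤ 2 ^ (0.6 * L) := by
  have hL0 : 0 < L := by linarith
  have hlog : 0 < Real.logb 2 L := Real.logb_pos (by norm_num) (by linarith)
  set d := ⌊L / (2 * Real.logb 2 L)⌋₊ with hd
  set y : ℝ := L ^ (-(1.1:ℝ)) with hy
  have hy0 : 0 < y := Real.rpow_pos_of_pos hL0 _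
  have hy1 : y ≤ 1 := Real.rpow_le_one_of_one_le_of_nonpos (by linarith) (by norm_num)
  refine (monos_card N d hy0 hy1).trans ?_
  have hdle : (d : ℝ) ≤ L / (2 * Real.logb 2 L) := Nat.floor_le (by positivity)
  have h1 : (y⁻¹) ^ d ≤ 2 ^ (0.55 * L) := by
    have e1 : y⁻¹ = 2 ^ (Real.logb 2 L * 1.1) := by
      rw [hy, Real.rpow_neg hL0.le, inv_inv, Real.rpow_mul (by norm_num),
        Real.rpow_logb (by norm_num) (by norm_num) hL0]
    rw [e1, ← Real.rpow_natCast, ← Real.rpow_mul (by norm_num)]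
    apply Real.rpow_le_rpow_of_exponent_le (by norm_num)
    rw [le_div_iff₀ (by positivity)] at hdle
    nlinarith
  have h2 : (1 + y) ^ N ≤ 2 ^ (0.05 * L) := by
    have e1 : (1 + y) ^ N ≤ Real.exp (N * y) := by
      rw [Real.exp_nat_mul]
      gcongr
      linarith [Real.add_one_le_exp y]
    have e2 : (N : ℝ) * y ≤ C * L ^ (0.9 : ℝ) := by
      have : L ^ (0.9 : ℝ) = L ^ 2 * y := by
        rw [hy, ← Real.rpow_natCast, ← Real.rpow_add hL0]
        norm_num
      rw [this, ← mul_assoc]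
      gcongr
    have e3 : C * L ^ (0.9 : ℝ) ≤ 0.03 * L := by
      have : L = L ^ (0.1 : ℝ) * L ^ (0.9 : ℝ) := by
        rw [← Real.rpow_add hL0]
        norm_num
      have h9 : 0 < L ^ (0.9 : ℝ) := Real.rpow_pos_of_pos hL0 _
      rw [div_le_iff₀ (by norm_num)] at hE
      calc C * L ^ (0.9 : ℝ) ≤ (L ^ (0.1 : ℝ) * 0.03) * L ^ (0.9 : ℝ) := by gcongr
        _ = 0.03 * (L ^ (0.1 : ℝ) * L ^ (0.9 : ℝ)) := by ring
        _ = 0.03 * L := by rw [← this]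
    refine e1.trans ?_
    rw [Real.rpow_def_of_pos (by norm_num)]
    apply Real.exp_le_exp.2
    have := Real.log_two_gt_d9
    nlinarith
  calc _ ≤ (2:ℝ) ^ (0.55 * L) * 2 ^ (0.05 * L) := by gcongr
    _ = 2 ^ (0.6 * L) := by
      rw [← Real.rpow_add (by norm_num)]
      congr 1
      ring

lemma hm_bound {n D l : ℕ} {L r : ℝ} (hn2 : (2:ℝ) ^ L = n) (hL : 2000 ≤ L)
    (hD : 1 ≤ D) (hr : r = (n:ℝ) ^ (-(0.9:ℝ))) (hl : (1 / 2 * (1 / 4) ^ ⌊D * L / 250⌋₊) / 2 *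
      ((n : ℝ) * r) ^ l ≤ 1) : l ≤ D / 10 := by
  set h := ⌊D * L / 250⌋₊ with hh
  have hL0 : 0 < L := by linarith
  have hhle : (h : ℝ) ≤ D * L / 250 := Nat.floor_le (by positivity)
  have hnpos : (0:ℝ) < n := by rw [← hn2]; positivity
  have e1 : (n:ℝ) * r = 2 ^ (0.1 * L) := by
    rw [hr, ← hn2, ← Real.rpow_mul (by norm_num), ← Real.rpow_add (by norm_num)]
    congr 1
    ring
  have e2 : ((1:ℝ) / 2 * (1 / 4) ^ h) / 2 = 2 ^ (-(2 * (h:ℝ) + 2)) := by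
    have : (2:ℝ) ^ (2 * (h:ℝ) + 2) = 4 ^ h * 4 := by
      have h' : (2 * (h:ℝ) + 2) = ((2 * h + 2 : ℕ) : ℝ) := by push_cast; ring
      rw [h', Real.rpow_natCast, pow_add, pow_mul]
      norm_num
    rw [Real.rpow_neg (by norm_num), this, one_div_pow]
    field_simp
    norm_num
  rw [e1, e2, ← Real.rpow_natCast, ← Real.rpow_mul (by norm_num),
    ← Real.rpow_add (by norm_num)] at hl
  have h3 : -(2 * (h:ℝ) + 2) + 0.1 * L * l ≤ 0 := by
    by_contra hc
    push Not at hc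
    have := Real.one_lt_rpow (x := 2) (by norm_num) hc
    linarith
  have hD' : (1:ℝ) ≤ D := by exact_mod_cast hD
  have h4 : (10:ℝ) * l ≤ D := by
    have : L * (10 * l) ≤ L * D := by nlinarith
    exact le_of_mul_le_mul_left this hL0
  have h5 : 10 * l ≤ D := by exact_mod_cast h4
  omega

lemma len_bound {n D : ℕ} {L : ℝ} (hn2 : (2:ℝ) ^ L = n) (hL : 2000 ≤ L)
    (hD : 1 ≤ D) : (n : ℝ) ^ (1 / 1000 * (D:ℝ)) ≤ (5 / 4) ^ ⌊D * L / 250⌋₊ := by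
  set h := ⌊D * L / 250⌋₊ with hh
  have h1 : D * L / 250 < (h : ℝ) + 1 := Nat.lt_floor_add_one _
  have hD' : (1:ℝ) ≤ D := by exact_mod_cast hD
  have h2 : (2:ℝ) ^ (0.3:ℝ) ≤ 5 / 4 := by
    have : ((2:ℝ) ^ (0.3:ℝ)) ^ 10 ≤ (5 / 4) ^ 10 := by
      rw [← Real.rpow_natCast, ← Real.rpow_mul (by norm_num)]
      norm_num
    exact le_of_pow_le_pow_left₀ (by norm_num) (by norm_num) this
  calc (n : ℝ) ^ (1 / 1000 * (D:ℝ)) = 2 ^ (L * (1 / 1000 * (D:ℝ))) := by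
        rw [← hn2, ← Real.rpow_mul (by norm_num)]
    _ ≤ 2 ^ (0.3 * (h:ℝ)) := by
        apply Real.rpow_le_rpow_of_exponent_le (by norm_num)
        nlinarith
    _ = ((2:ℝ) ^ (0.3:ℝ)) ^ h := by rw [Real.rpow_mul (by norm_num), Real.rpow_natCast]
    _ ≤ _ := by gcongr

lemma rp_bound {n D : ℕ} {r p : ℝ} (hn : 1 ≤ n) (hD : 1 ≤ D) (hr : r = (n:ℝ) ^ (-(0.9:ℝ)))
    (hp : p = (n : ℝ) ^ (-(2 : ℝ) / (D : ℝ))) :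
    r * (p⁻¹) ^ (D / 10) ≤ (n:ℝ) ^ (-(0.7:ℝ)) := by
  have hn' : (1:ℝ) ≤ n := by exact_mod_cast hn
  have hn0 : (0:ℝ) < n := by linarith
  have hD' : (1:ℝ) ≤ D := by exact_mod_cast hD
  rw [hr, hp, ← Real.rpow_neg hn0.le, ← Real.rpow_natCast, ← Real.rpow_mul hn0.le,
    ← Real.rpow_add hn0]
  apply Real.rpow_le_rpow_of_exponent_le hn'
  have h1 : 10 * (D / 10) ≤ D := Nat.mul_div_le D 10
  have h2 : (10:ℝ) * ((D / 10 : ℕ) : ℝ) ≤ D := by exact_mod_cast h1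
  have h3 : -(-(2:ℝ) / D) * ((D / 10 : ℕ) : ℝ) ≤ 0.2 := by
    have : -(-(2:ℝ) / D) * ((D / 10 : ℕ) : ℝ) = 2 * ((D / 10 : ℕ) : ℝ) / D := by ring
    rw [this, div_le_iff₀ (by linarith)]
    linarith
  linarith

lemma final_bound {k n N M h f : ℕ} {L z γ y : ℝ} (hγ : 0 < γ) (hn2 : (2:ℝ) ^ L = n)
    (hL : 2000 ≤ L) (hLz : L ≤ z) (hz : 300 ≤ z) (hzγ : -Real.log γ ≤ z) (hk : (k:ℝ) ≤ z ^ 2)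
    (hk1 : 1 ≤ k)
    (hN : (N:ℝ) ≤ z ^ 4) (hM : (M:ℝ) ≤ z ^ 60) (hM1 : 1 ≤ M) (hh : (h:ℝ) ≤ z ^ 2)
    (hf1 : 1 ≤ f)
    (hf : f ≤ (2 ^ N + 1) ^ M + 3 ^ N) (hy0 : 0 < y) (hy : y ≤ (z ^ 70)⁻¹) :
    ((h:ℝ) + 1) * (2 * f) ^ h * (2 ^ k * n ^ k) * Real.exp (-(1 / (2 * (8 * (k * y))))) ≤ γ := by
  have hz0 : 0 < z := by linarith
  have hf2 : (2 * f : ℕ) ≤ 2 ^ (4 * (N + 1) * M) := by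
    have h1 : 2 ^ N + 1 ≤ 2 ^ (N + 1) := by
      have := Nat.one_le_two_pow (n := N)
      rw [pow_succ]; omega
    have h2 : (2 ^ N + 1) ^ M ≤ 2 ^ ((N + 1) * M) := by
      rw [pow_mul]
      exact Nat.pow_le_pow_left h1 M
    have h3 : 3 ^ N ≤ 2 ^ (2 * N) := by
      rw [pow_mul]
      exact Nat.pow_le_pow_left (by norm_num) N
    have h4 : 2 ^ ((N + 1) * M) ≤ 2 ^ (2 * (N + 1) * M) :=
      Nat.pow_le_pow_right (by norm_num) (by nlinarith)
    have h5 : 2 ^ (2 * N) ≤ 2 ^ (2 * (N + 1) * M) :=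
      Nat.pow_le_pow_right (by norm_num) (by nlinarith)
    calc 2 * f ≤ 2 * (2 ^ (2 * (N + 1) * M) + 2 ^ (2 * (N + 1) * M)) := by omega
      _ = 2 ^ (2 * (N + 1) * M + 2) := by rw [pow_add]; ring
      _ ≤ _ := Nat.pow_le_pow_right (by norm_num) (by nlinarith)
  have hf3 : (2 * (f:ℝ)) ≤ 2 ^ (4 * (N + 1) * M) := by exact_mod_cast hf2
  have hh1 : (h:ℝ) + 1 ≤ 2 ^ h := by exact_mod_cast Nat.lt_two_pow_self (n := h)
  set E : ℝ := h + 4 * (N + 1) * M * h + k + L * k with hE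
  have hprod : ((h:ℝ) + 1) * (2 * f) ^ h * (2 ^ k * n ^ k) ≤ Real.exp E := by
    calc ((h:ℝ) + 1) * (2 * f) ^ h * (2 ^ k * n ^ k)
        ≤ 2 ^ h * (2 ^ (4 * (N + 1) * M)) ^ h * (2 ^ k * n ^ k) := by gcongr
      _ = 2 ^ E := by
        rw [hE, Real.rpow_add (by norm_num), Real.rpow_add (by norm_num),
          Real.rpow_add (by norm_num), Real.rpow_mul (by norm_num) L, hn2, Real.rpow_natCast,
          Real.rpow_natCast, Real.rpow_natCast, ← pow_mul]
        have : (4 * ((N:ℝ) + 1) * M * h) = ((4 * (N + 1) * M * h : ℕ) : ℝ) := by push_cast; ring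
        rw [this, Real.rpow_natCast]
        ring
      _ ≤ Real.exp E := by
        rw [Real.rpow_def_of_pos (by norm_num)]
        apply Real.exp_le_exp.2
        have := Real.log_two_lt_d9
        have hE0 : 0 ≤ E := by rw [hE]; positivity
        nlinarith
  have hE2 : E ≤ 15 * z ^ 67 := by
    have hN1 : (N:ℝ) + 1 ≤ z ^ 5 := by
      have : z ^ 5 = z ^ 4 * z := by ring
      have h4 : 1 ≤ z ^ 4 := one_le_pow₀ (by linarith)
      nlinarith
    have t1 : 4 * ((N:ℝ) + 1) * M * h ≤ 4 * z ^ 5 * z ^ 60 * z ^ 2 := by gcongr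
    have t2 : L * k ≤ z * z ^ 2 := by gcongr
    have t3 : z ^ 2 ≤ z ^ 67 := pow_le_pow_right₀ (by linarith) (by norm_num)
    have t4 : z ^ 3 ≤ z ^ 67 := pow_le_pow_right₀ (by linarith) (by norm_num)
    have t5 : 0 ≤ z ^ 67 := by positivity
    have t6 : 4 * z ^ 5 * z ^ 60 * z ^ 2 = 4 * z ^ 67 := by ring
    have t7 : z * z ^ 2 = z ^ 3 := by ring
    rw [hE]
    linarith
  have hexp : 16 * z ^ 67 ≤ 1 / (2 * (8 * (k * y))) := by
    have hk0 : (0:ℝ) < k := by exact_mod_cast hk1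
    rw [le_div_iff₀ (by positivity)]
    calc 16 * z ^ 67 * (2 * (8 * (k * y))) ≤ 16 * z ^ 67 * (2 * (8 * (z ^ 2 * (z ^ 70)⁻¹))) := by
          gcongr
      _ = 256 * z⁻¹ := by field_simp; ring
      _ ≤ 1 := by
        rw [← div_eq_mul_inv, div_le_one hz0]
        linarith
  have hg : z ≤ z ^ 67 := by
    calc z = z ^ 1 := (pow_one z).symm
      _ ≤ _ := pow_le_pow_right₀ (by linarith) (by norm_num)
  calc _ ≤ Real.exp E * Real.exp (-(1 / (2 * (8 * (k * y))))) := by gcongr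
    _ = Real.exp (E + -(1 / (2 * (8 * (k * y))))) := (Real.exp_add _ _).symm
    _ ≤ Real.exp (Real.log γ) := by
      apply Real.exp_le_exp.2
      linarith
    _ = γ := Real.exp_log hγ

lemma eventually_params (A B : ℝ) : ∃ n₀ : ℕ, ∀ n ≥ n₀, 2000 ≤ Real.logb 2 n ∧
    A ≤ Real.logb 2 n ^ (0.1 : ℝ) ∧ Real.logb 2 n ≤ (n:ℝ) ^ (0.01 : ℝ) ∧ B ≤ (n:ℝ) ^ (0.01:ℝ) := by
  have hcast : Filter.Tendsto (fun n : ℕ => (n:ℝ)) Filter.atTop Filter.atTop :=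
    tendsto_natCast_atTop_atTop
  have hL : Filter.Tendsto (fun n : ℕ => Real.logb 2 n) Filter.atTop Filter.atTop :=
    (Real.tendsto_logb_atTop (by norm_num)).comp hcast
  have h2 := ((tendsto_rpow_atTop (y := 0.1) (by norm_num)).comp hL).eventually_ge_atTop A
  have h4 := ((tendsto_rpow_atTop (y := 0.01) (by norm_num)).comp hcast).eventually_ge_atTop B
  have h3 : ∀ᶠ n : ℕ in Filter.atTop, Real.logb 2 n ≤ (n:ℝ) ^ (0.01 : ℝ) := by
    have h := (isLittleO_log_rpow_atTop (r := 0.01) (by norm_num)).bound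
      (c := Real.log 2) (Real.log_pos (by norm_num))
    filter_upwards [hcast.eventually h, hL.eventually_ge_atTop 0] with n hn hn0
    have hl2 : 0 < Real.log 2 := Real.log_pos (by norm_num)
    rw [Real.logb, div_le_iff₀ hl2, mul_comm]
    refine (le_abs_self _).trans ?_
    have h5 : (0:ℝ) ≤ (n:ℝ) ^ (0.01 : ℝ) := by positivity
    simpa [Real.norm_eq_abs, abs_of_nonneg h5] using hn
  have := (((hL.eventually_ge_atTop 2000).and h2).and h3).and h4
  obtain ⟨n₀, hn₀⟩ := Filter.eventually_atTop.1 this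
  exact ⟨n₀, fun n hn => ⟨(hn₀ n hn).1.1.1, (hn₀ n hn).1.1.2, (hn₀ n hn).1.2, (hn₀ n hn).2⟩⟩

/-- Corollary 4.9: for every constant `α > 0` there is a constant
`c > 0` such that for all integers `D, k, n` with `D ≤ 2 log n` and `k = ⌈αD⌉`: if
`G ∼ G(n,k,n^{−2/D})`, then with probability tending to `1` as `n → ∞` every tree-like
semantic `Th(⌊log n / (2 log log n)⌋)` refutation of `bclique_b(G,k)` has length at
least `n^{cD}`. -/
theorem treelike_threshold_lower_bound :
    ∀ α : ℝ, 0 < α →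
      ∃ c > (0 : ℝ), ∀ γ > (0 : ℝ), ∃ n₀ : ℕ, ∀ n ≥ n₀, ∀ k D : ℕ,
        1 ≤ D → (D : ℝ) ≤ 2 * Real.logb 2 n → k = ⌈α * (D : ℝ)⌉₊ →
        1 - γ ≤
          probG k n ((n : ℝ) ^ (-(2 : ℝ) / (D : ℝ))) (fun G =>
            ∀ π : SemProof (k * Nat.clog 2 n),
              IsRefutation
                (ThLines (k * Nat.clog 2 n)
                  ⌊Real.logb 2 n / (2 * Real.logb 2 (Real.logb 2 n))⌋₊)
                (bcliqueB k n G) π →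
              (n : ℝ) ^ (c * (D : ℝ)) ≤ (π.length : ℝ)) := by
  intro α hα
  refine ⟨1 / 1000, by norm_num, fun γ hγ => ?_⟩
  obtain ⟨n₀, hn₀⟩ := eventually_params ((2 * α + 1) * 2 / 0.03)
    (2 * α + 1 + |Real.log γ| + 300)
  refine ⟨n₀, fun n hn k D hD hDL hk => ?_⟩
  obtain ⟨hL, hE, hLz, hz⟩ := hn₀ n hn
  set L := Real.logb 2 n with hLdef
  set z := (n:ℝ) ^ (0.01:ℝ) with hzdef
  have hL0 : 0 < L := by linarith
  have hn1 : 1 ≤ n := by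
    rcases Nat.eq_zero_or_pos n with h0 | h0
    · exfalso
      rw [hLdef, h0] at hL0
      simp at hL0
    · exact h0
  have hn1' : (1:ℝ) ≤ n := by exact_mod_cast hn1
  have hn0 : (0:ℝ) < n := by linarith
  have hn2 : (2:ℝ) ^ L = n := Real.rpow_logb (by norm_num) (by norm_num) hn0
  have hD' : (1:ℝ) ≤ D := by exact_mod_cast hD
  have habs := neg_le_abs (Real.log γ)
  have habs0 := abs_nonneg (Real.log γ)
  have hz0 : 0 < z := by linarith
  set p : ℝ := (n : ℝ) ^ (-(2 : ℝ) / (D : ℝ)) with hp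
  set r : ℝ := (n:ℝ) ^ (-(0.9:ℝ)) with hr
  set h : ℕ := ⌊D * L / 250⌋₊ with hh
  set N := k * Nat.clog 2 n with hN
  set d := ⌊L / (2 * Real.logb 2 L)⌋₊ with hd
  have hp0 : 0 < p := Real.rpow_pos_of_pos hn0 _
  have hp1 : p ≤ 1 := Real.rpow_le_one_of_one_le_of_nonpos hn1'
    (div_nonpos_of_nonpos_of_nonneg (by norm_num) (by linarith))
  have hr0 : 0 < r := Real.rpow_pos_of_pos hn0 _
  have hngt : (1:ℝ) < n := by
    rw [← hn2]
    exact Real.one_lt_rpow (by norm_num) hL0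
  have hr1 : r < 1 := Real.rpow_lt_one_of_one_lt_of_neg hngt (by norm_num)
  have hnr : 1 ≤ n * r := by
    have : (n:ℝ) * r = (n:ℝ) ^ (0.1:ℝ) := by
      rw [hr]
      nth_rewrite 1 [← Real.rpow_one (n:ℝ)]
      rw [← Real.rpow_add hn0]
      norm_num
    rw [this]
    exact Real.one_le_rpow hn1' (by norm_num)
  have hk1 : 1 ≤ k := by
    rw [hk]
    exact Nat.ceil_pos.2 (by positivity)
  have hkL : (k:ℝ) ≤ (2 * α + 1) * L := by
    have h1 : (k:ℝ) < α * D + 1 := by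
      rw [hk]
      exact Nat.ceil_lt_add_one (by positivity)
    nlinarith
  have hkz : (k:ℝ) ≤ z ^ 2 := by
    have : (2 * α + 1) * L ≤ z * z := by
      apply mul_le_mul _ hLz hL0.le hz0.le
      linarith
    nlinarith
  have hclog : (Nat.clog 2 n : ℝ) ≤ L + 1 := by
    have h1 := Real.natCeil_logb_natCast 2 n
    have h2 : ((⌈Real.logb (2:ℕ) n⌉₊ : ℕ) : ℝ) < Real.logb (2:ℕ) n + 1 :=
      Nat.ceil_lt_add_one (by exact_mod_cast hL0.le)
    rw [h1] at h2
    exact_mod_cast h2.le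
  have hNL : (N:ℝ) ≤ ((2 * α + 1) * 2) * L ^ 2 := by
    rw [hN]
    push_cast
    calc (k:ℝ) * Nat.clog 2 n ≤ ((2 * α + 1) * L) * (2 * L) := by
          gcongr
          linarith
      _ = _ := by ring
  have hNz : (N:ℝ) ≤ z ^ 4 := by
    rw [hN]
    push_cast
    calc (k:ℝ) * Nat.clog 2 n ≤ z ^ 2 * z ^ 2 := by
          gcongr
          nlinarith
      _ = _ := by ring
  have hMz : ((monos N d).card : ℝ) ≤ z ^ 60 := by
    refine (monos_bound hL hE hNL).trans (le_of_eq ?_)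
    rw [mul_comm, Real.rpow_mul (by norm_num), hn2, hzdef, ← Real.rpow_natCast,
      ← Real.rpow_mul hn0.le]
    norm_num
  have hM1 : 1 ≤ (monos N d).card :=
    Finset.card_pos.2 ⟨∅, by simp [monos]⟩
  have hhz : (h:ℝ) ≤ z ^ 2 := by
    have h1 : (h:ℝ) ≤ D * L / 250 := Nat.floor_le (by positivity)
    nlinarith
  have hry : r * (p⁻¹) ^ (D / 10) ≤ (z ^ 70)⁻¹ := by
    refine (rp_bound hn1 hD hr hp).trans (le_of_eq ?_)
    rw [hzdef, ← Real.rpow_natCast, ← Real.rpow_mul hn0.le, ← Real.rpow_neg hn0.le]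
    norm_num
  have hky : k * (r * (p⁻¹) ^ (D / 10)) ≤ 1 := by
    calc (k:ℝ) * (r * (p⁻¹) ^ (D / 10)) ≤ z ^ 2 * (z ^ 70)⁻¹ := by gcongr
      _ ≤ z ^ 70 * (z ^ 70)⁻¹ := by
        gcongr
        · linarith
        · norm_num
      _ = 1 := mul_inv_cancel₀ (by positivity)
  obtain ⟨F', hF1, hF2, hFc1, hFc⟩ := exists_family (d := d) (N := N) (encT (k := k) (n := n))
  have hub := union_bound (m := D / 10) (τ := 1 / 2 * (1 / 4) ^ h) hk1 hn1 hp0 hp1 hr0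
    (by positivity) (fun l hl => hm_bound hn2 hL hD hr hl) hky F' hFc1 h
    (fun G => ∀ π : SemProof (k * Nat.clog 2 n),
      IsRefutation (ThLines (k * Nat.clog 2 n) d) (bcliqueB k n G) π →
      (n : ℝ) ^ (1 / 1000 * (D : ℝ)) ≤ (π.length : ℝ)) (fun G _ hJ π hπ =>
        (len_bound hn2 hL hD).trans
          (length_lower hr0 hr1 hn1 hnr F' hF1 hF2 h rfl hJ π hπ))
  have hfin := final_bound hγ hn2 hL hLz (by linarith) (by linarith) hkz hk1 hNz hMz hM1 hhz hFc1
    hFc (y := r * (p⁻¹) ^ (D / 10)) (by positivity) hry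
  linarith
end

section
/- For all integers D, k, n satisfying k ≤ n^{1/5} and D ≤ 2 log n, with p = n^{−2/D}, the following holds asymptotically almost surely for G ~ G(n,k,p): for every block index i ∈ [k], every integer a ≤ D/4, and every a-tuple t of vertices of G disjoint from V_i, the common neighborhood N^∩(t, V_i) := V_i ∩ ∩_{u∈t} N(u) satisfies (1 − 1/k)·p^a·n ≤ |N^∩(t, V_i)| ≤ (1 + 1/k)·p^a·n. -/
open Finset

open Classical in
/-- The common neighbourhood `N^∩(t, V_i) = V_i ∩ ∩_{u ∈ t} N(u)` of a set `t` of
vertices inside the block `V_i`. -/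
noncomputable def commonNbhd {k n : ℕ} (G : Finset (Sym2 (Vtx k n)))
    (t : Finset (Vtx k n)) (i : Fin k) : Finset (Fin n) :=
  Finset.univ.filter fun w => ∀ u ∈ t, s(((i, w) : Vtx k n), u) ∈ G

noncomputable section CNC

def wtG {α : Type*} (p : ℝ) (E G : Finset α) : ℝ := p ^ G.card * (1 - p) ^ (E.card - G.card)

open Classical in
lemma sum_wt_superset {α : Type*} (p : ℝ) (E S : Finset α) (hS : S ⊆ E) :
    ∑ G ∈ E.powerset, (if S ⊆ G then wtG p E G else 0) = p ^ S.card := by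
  have h := Finset.prod_add (fun _ : α => p) (fun e => if e ∈ S then 0 else 1 - p) E
  have h1 : ∏ e ∈ E, (p + if e ∈ S then 0 else 1 - p) = p ^ S.card := by
    have : ∀ e ∈ E, (p + if e ∈ S then 0 else 1 - p) = if e ∈ S then p else 1 := by
      intro e _; split_ifs <;> ring
    rw [Finset.prod_congr rfl this, Finset.prod_ite]
    have h2 : E.filter (fun e => e ∈ S) = S := by
      ext e; simp only [Finset.mem_filter]; exact ⟨fun h => h.2, fun h => ⟨hS h, h⟩⟩
    rw [h2]; simp
  rw [← h1, h]
  refine Finset.sum_congr rfl fun G hG => ?_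
  have hGE := Finset.mem_powerset.1 hG
  split_ifs with hs
  · rw [wtG, Finset.prod_const, ← Finset.card_sdiff_of_subset hGE]
    congr 1
    rw [Finset.prod_congr rfl (g := fun _ => 1 - p), Finset.prod_const]
    intro e he
    rw [if_neg]
    intro h'; exact (Finset.mem_sdiff.1 he).2 (hs h')
  · obtain ⟨e, he, heG⟩ := Finset.not_subset.1 hs
    rw [Finset.prod_eq_zero (i := e) (s := E \ G), mul_zero]
    · simp [hS he, heG]
    · simp [he]

lemma sum_wt {α : Type*} (p : ℝ) (E : Finset α) : ∑ G ∈ E.powerset, wtG p E G = 1 := by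
  classical
  simpa using sum_wt_superset p E ∅ (by simp)

open Classical in
def starE {k n : ℕ} (t : Finset (Vtx k n)) (i : Fin k) (W : Finset (Fin n)) :
    Finset (Sym2 (Vtx k n)) :=
  (W ×ˢ t).image (fun x => s(((i, x.1) : Vtx k n), x.2))

lemma starE_sub {k n : ℕ} (t : Finset (Vtx k n)) (i : Fin k) (W : Finset (Fin n))
    (ht : ∀ u ∈ t, u.1 ≠ i) : starE t i W ⊆ potEdges k n := by
  classical
  intro e he
  simp only [starE, Finset.mem_image, Finset.mem_product] at he
  obtain ⟨⟨w, u⟩, ⟨hw, hu⟩, rfl⟩ := he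
  simp only [potEdges, Finset.mem_filter, Finset.mem_univ, true_and, Sym2.map_mk,
    Sym2.mk_isDiag_iff]
  exact fun h => ht u hu h.symm

lemma starE_card {k n : ℕ} (t : Finset (Vtx k n)) (i : Fin k) (W : Finset (Fin n))
    (ht : ∀ u ∈ t, u.1 ≠ i) : (starE t i W).card = t.card * W.card := by
  classical
  rw [starE, Finset.card_image_of_injOn, Finset.card_product, mul_comm]
  rintro ⟨w, u⟩ h1 ⟨w', u'⟩ h2 h
  simp only [Finset.coe_product, Set.mem_prod, Finset.mem_coe] at h1 h2
  simp only [Sym2.eq_iff] at h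
  rcases h with ⟨h, h'⟩ | ⟨h, h'⟩
  · simp only [Prod.mk.injEq, true_and] at h
    rw [h, h']
  · exact absurd (congrArg Prod.fst h).symm (ht u' h2.2)

lemma mgf {k n : ℕ} (p z : ℝ) (t : Finset (Vtx k n)) (i : Fin k) (ht : ∀ u ∈ t, u.1 ≠ i) :
    ∑ G ∈ (potEdges k n).powerset, wtG p (potEdges k n) G * z ^ (commonNbhd G t i).card
      = (1 + (z - 1) * p ^ t.card) ^ n := by
  classical
  have h1 : ∀ G : Finset (Sym2 (Vtx k n)), z ^ (commonNbhd G t i).card =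
      ∑ W ∈ (Finset.univ : Finset (Fin n)).powerset,
        if starE t i W ⊆ G then (z - 1) ^ W.card else 0 := by
    intro G
    have : z ^ (commonNbhd G t i).card = ∏ w : Fin n,
        (1 + if (∀ u ∈ t, s(((i, w) : Vtx k n), u) ∈ G) then z - 1 else 0) := by
      rw [commonNbhd, ← Finset.prod_const, Finset.prod_filter]
      refine Finset.prod_congr rfl fun w _ => ?_
      split_ifs <;> ring
    rw [this, Finset.prod_one_add]
    refine Finset.sum_congr rfl fun W _ => ?_
    rw [Finset.prod_ite_zero, Finset.prod_const]
    congr 1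
    simp only [starE, Finset.image_subset_iff, Finset.mem_product, eq_iff_iff]
    constructor
    · intro h x hh; exact h x.1 hh.1 x.2 hh.2
    · intro h w hw u hu; exact h (w, u) ⟨hw, hu⟩
  simp_rw [h1, Finset.mul_sum]
  rw [Finset.sum_comm]
  have h2 : ∀ W ∈ (Finset.univ : Finset (Fin n)).powerset,
      ∑ G ∈ (potEdges k n).powerset, wtG p (potEdges k n) G *
        (if starE t i W ⊆ G then (z - 1) ^ W.card else 0) =
      ∏ w ∈ W, ((z - 1) * p ^ t.card) := by
    intro W _
    rw [Finset.prod_const, mul_pow, ← pow_mul, ← starE_card t i W ht,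
      ← sum_wt_superset p _ _ (starE_sub t i W ht), Finset.mul_sum]
    refine Finset.sum_congr rfl fun G _ => ?_
    split_ifs <;> ring
  rw [Finset.sum_congr rfl h2, ← Finset.prod_one_add]
  simp

lemma wtG_nonneg {α : Type*} {p : ℝ} (h0 : 0 ≤ p) (h1 : p ≤ 1) (E G : Finset α) :
    0 ≤ wtG p E G := by
  have : 0 ≤ 1 - p := by linarith
  unfold wtG; positivity

lemma mgf_le {k n : ℕ} {p : ℝ} (h0 : 0 ≤ p) (h1 : p ≤ 1) (s : ℝ) (hs : |s| ≤ 1)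
    (t : Finset (Vtx k n)) (i : Fin k) (ht : ∀ u ∈ t, u.1 ≠ i) :
    ∑ G ∈ (potEdges k n).powerset, wtG p (potEdges k n) G *
      Real.exp (s * (commonNbhd G t i).card) ≤ Real.exp ((s + s ^ 2) * (p ^ t.card * n)) := by
  have h := mgf p (Real.exp s) t i ht
  have e : ∀ G : Finset (Sym2 (Vtx k n)), Real.exp (s * (commonNbhd G t i).card) =
      Real.exp s ^ (commonNbhd G t i).card := by
    intro G; rw [mul_comm, Real.exp_nat_mul]
  simp_rw [e]
  rw [h]
  have hq0 : 0 ≤ p ^ t.card := pow_nonneg h0 _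
  have hq1 : p ^ t.card ≤ 1 := pow_le_one₀ h0 h1
  have hb : Real.exp s - 1 ≤ s + s ^ 2 := by
    have := abs_le.1 (Real.abs_exp_sub_one_sub_id_le hs)
    linarith [this.2]
  have hpos := Real.exp_pos s
  have hbase : 0 ≤ 1 + (Real.exp s - 1) * p ^ t.card := by nlinarith
  calc _ ≤ (Real.exp ((s + s ^ 2) * p ^ t.card)) ^ n := by
        apply pow_le_pow_left₀ hbase
        have h3 := Real.add_one_le_exp ((s + s ^ 2) * p ^ t.card)
        nlinarith [mul_le_mul_of_nonneg_right hb hq0]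
    _ = _ := by rw [← Real.exp_nat_mul]; congr 1; ring

open Classical in
lemma tails {k n : ℕ} {p δ : ℝ} (h0 : 0 ≤ p) (h1 : p ≤ 1) (hd0 : 0 ≤ δ) (hd1 : δ ≤ 1)
    (t : Finset (Vtx k n)) (i : Fin k) (ht : ∀ u ∈ t, u.1 ≠ i) :
    ∑ G ∈ (potEdges k n).powerset, (if ¬ ((1 - δ) * p ^ t.card * n ≤ ((commonNbhd G t i).card : ℝ)
      ∧ ((commonNbhd G t i).card : ℝ) ≤ (1 + δ) * p ^ t.card * n) then
        wtG p (potEdges k n) G else 0) ≤ 2 * Real.exp (-(δ ^ 2 * (p ^ t.card * n) / 4)) := by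
  set μ := p ^ t.card * n with hμ
  have hu := mgf_le h0 h1 (δ / 2) (by rw [abs_of_nonneg] <;> linarith) t i ht
  have hl := mgf_le h0 h1 (-(δ / 2)) (by rw [abs_neg, abs_of_nonneg] <;> linarith) t i ht
  rw [← hμ] at hu hl
  have hu' := mul_le_mul_of_nonneg_right hu (Real.exp_pos (-(δ / 2 * ((1 + δ) * μ)))).le
  have hl' := mul_le_mul_of_nonneg_right hl (Real.exp_pos ((δ / 2 * ((1 - δ) * μ)))).le
  rw [← Real.exp_add, Finset.sum_mul] at hu' hl'
  have eu : (δ / 2 + (δ / 2) ^ 2) * μ + -(δ / 2 * ((1 + δ) * μ)) = -(δ ^ 2 * μ / 4) := by ring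
  have el : (-(δ / 2) + (-(δ / 2)) ^ 2) * μ + (δ / 2 * ((1 - δ) * μ)) = -(δ ^ 2 * μ / 4) := by
    ring
  rw [eu] at hu'
  rw [el] at hl'
  rw [two_mul]
  refine le_trans ?_ (add_le_add hu' hl')
  rw [← Finset.sum_add_distrib]
  refine Finset.sum_le_sum fun G _ => ?_
  have hw := wtG_nonneg h0 h1 (potEdges k n) G
  rw [mul_assoc (wtG p (potEdges k n) G), mul_assoc (wtG p (potEdges k n) G), ← Real.exp_add,
    ← Real.exp_add]
  set X : ℝ := ((commonNbhd G t i).card : ℝ)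
  have a1 := mul_nonneg hw (Real.exp_pos (δ / 2 * X + -(δ / 2 * ((1 + δ) * μ)))).le
  have a2 := mul_nonneg hw (Real.exp_pos (-(δ / 2) * X + (δ / 2 * ((1 - δ) * μ)))).le
  split_ifs with hc
  · linarith
  · rw [not_and_or, not_le, not_le, mul_assoc, mul_assoc, ← hμ] at hc
    rcases hc with hc | hc
    · have : 1 ≤ Real.exp (-(δ / 2) * X + (δ / 2 * ((1 - δ) * μ))) := by
        apply Real.one_le_exp; nlinarith
      nlinarith
    · have : 1 ≤ Real.exp (δ / 2 * X + -(δ / 2 * ((1 + δ) * μ))) := by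
        apply Real.one_le_exp; nlinarith
      nlinarith

lemma card_small {α : Type*} [Fintype α] [DecidableEq α] (m : ℕ) :
    ((Finset.univ : Finset (Finset α)).filter (fun t => t.card ≤ m)).card
      ≤ (Fintype.card α + 1) ^ m := by
  have hs : (Finset.univ : Finset (Finset α)).filter (fun t => t.card ≤ m) ⊆
      (Finset.range (m + 1)).biUnion (fun a => Finset.powersetCard a Finset.univ) := by
    intro t ht
    simp only [Finset.mem_filter, Finset.mem_univ, true_and] at ht
    simp only [Finset.mem_biUnion, Finset.mem_range, Finset.mem_powersetCard]
    exact ⟨t.card, by omega, Finset.subset_univ _, rfl⟩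
  refine (Finset.card_le_card hs).trans (Finset.card_biUnion_le.trans ?_)
  rw [add_pow]
  refine Finset.sum_le_sum fun a ha => ?_
  rw [Finset.card_powersetCard, Finset.card_univ, one_pow, mul_one]
  have : 0 < m.choose a := Nat.choose_pos (by simp at ha; omega)
  exact (Nat.choose_le_pow _ _).trans (Nat.le_mul_of_pos_right _ this)

lemma union_bd {k n m : ℕ} {p B : ℝ} (h0 : 0 ≤ p) (h1 : p ≤ 1)
    (Q : Fin k → Finset (Vtx k n) → Finset (Sym2 (Vtx k n)) → Prop)
    (R : Fin k → Finset (Vtx k n) → Prop) (hB : 0 ≤ B)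
    (hQ : ∀ i t, R i t → probG k n p (fun G => ¬ Q i t G) ≤ B)
    (hR : ∀ i t, R i t → t.card ≤ m) :
    1 - (k * (k * n + 1) ^ m : ℝ) * B ≤ probG k n p (fun G => ∀ i t, R i t → Q i t G) := by
  classical
  set T := (Finset.univ : Finset (Finset (Vtx k n))).filter (fun t => t.card ≤ m) with hT
  have hc : ((T.card : ℕ) : ℝ) ≤ (k * n + 1 : ℝ) ^ m := by
    have := card_small (α := Vtx k n) m
    simp only [Fintype.card_prod, Fintype.card_fin] at this
    exact_mod_cast this
  have hsum := sum_wt p (potEdges k n)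
  have key : ∑ G ∈ (potEdges k n).powerset, wtG p (potEdges k n) G ≤
      probG k n p (fun G => ∀ i t, R i t → Q i t G) +
      ∑ x ∈ (Finset.univ : Finset (Fin k)) ×ˢ T, ∑ G ∈ (potEdges k n).powerset,
        (if R x.1 x.2 ∧ ¬ Q x.1 x.2 G then wtG p (potEdges k n) G else 0) := by
    rw [Finset.sum_comm, probG, ← Finset.sum_add_distrib]
    refine Finset.sum_le_sum fun G _ => ?_
    have hw := wtG_nonneg h0 h1 (potEdges k n) G
    have hnn : ∀ x ∈ (Finset.univ : Finset (Fin k)) ×ˢ T,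
        0 ≤ (if R x.1 x.2 ∧ ¬ Q x.1 x.2 G then wtG p (potEdges k n) G else 0) := by
      intro x _; split_ifs <;> simp [hw]
    split_ifs with hP
    · exact le_add_of_nonneg_right (Finset.sum_nonneg hnn)
    · push Not at hP
      obtain ⟨i, t, hr, hq⟩ := hP
      have hm : (i, t) ∈ (Finset.univ : Finset (Fin k)) ×ˢ T := by
        simp [hT, hR i t hr]
      have := Finset.single_le_sum hnn hm
      simp only [hr, hq, not_false_eq_true, and_self, if_true] at this
      linarith
  have hb : ∑ x ∈ (Finset.univ : Finset (Fin k)) ×ˢ T, ∑ G ∈ (potEdges k n).powerset,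
        (if R x.1 x.2 ∧ ¬ Q x.1 x.2 G then wtG p (potEdges k n) G else 0) ≤
        ((Finset.univ : Finset (Fin k)) ×ˢ T).card • B := by
    refine Finset.sum_le_card_nsmul _ _ _ fun x _ => ?_
    by_cases hr : R x.1 x.2
    · refine le_trans (le_of_eq ?_) (hQ _ _ hr)
      rw [probG]
      refine Finset.sum_congr rfl fun G _ => ?_
      simp only [hr, true_and, wtG]
      congr
    · simp [hr, hB]
  rw [Finset.card_product, nsmul_eq_mul] at hb
  simp only [Finset.card_univ, Fintype.card_fin, Nat.cast_mul] at hb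
  have : (k : ℝ) * T.card * B ≤ (k * (k * n + 1) ^ m : ℝ) * B := by gcongr
  linarith

lemma asym : Filter.Tendsto (fun L : ℝ => 2 * Real.exp (3 * L ^ 2 + L - Real.exp (L / 10) / 4))
    Filter.atTop (nhds 0) := by
  have h : Filter.Tendsto (fun L : ℝ => Real.exp (L / 10) / 4 - (3 * L ^ 2 + L))
      Filter.atTop Filter.atTop := by
    have h1 : Filter.Tendsto (fun y : ℝ => Real.exp y / y ^ 2) Filter.atTop Filter.atTop :=
      Real.tendsto_exp_div_pow_atTop 2
    have h2 : Filter.Tendsto (fun L : ℝ => L / 10) Filter.atTop Filter.atTop :=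
      Filter.tendsto_id.atTop_div_const (by norm_num)
    have h3 := h1.comp h2
    refine Filter.tendsto_atTop_mono' _ ?_ Filter.tendsto_id
    filter_upwards [h3.eventually_ge_atTop 2000, Filter.eventually_ge_atTop 1] with L hL hL1
    simp only [Function.comp] at hL
    rw [le_div_iff₀ (by positivity)] at hL
    simp only [id]
    nlinarith
  have h4 := (Real.tendsto_exp_neg_atTop_nhds_zero.comp h).const_mul 2
  simp only [mul_zero] at h4
  refine h4.congr fun L => ?_
  simp only [Function.comp]
  congr 2; ring

end CNC

/-- Lemma 5.12: for all integers `D, k, n` with `k ≤ n^{1/5}` and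
`D ≤ 2 log n`, with `p = n^{−2/D}`, asymptotically almost surely for `G ∼ G(n,k,p)`:
for every block index `i`, every `a ≤ D/4` and every `a`-tuple `t` of vertices disjoint
from `V_i`, `(1 − 1/k)·pᵃ·n ≤ |N^∩(t, V_i)| ≤ (1 + 1/k)·pᵃ·n`. -/
theorem common_neighbourhoods_concentrate :
    ∀ γ > (0 : ℝ), ∃ n₀ : ℕ, ∀ n ≥ n₀, ∀ k D : ℕ,
      1 ≤ D → (k : ℝ) ≤ (n : ℝ) ^ ((1 : ℝ) / 5) → (D : ℝ) ≤ 2 * Real.logb 2 n →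
      1 - γ ≤
        probG k n ((n : ℝ) ^ (-(2 : ℝ) / (D : ℝ))) (fun G =>
          ∀ i : Fin k, ∀ a : ℕ, (a : ℝ) ≤ (D : ℝ) / 4 →
            ∀ t : Finset (Vtx k n), t.card = a →
              (∀ u ∈ t, ∀ v ∈ t, u ≠ v → u.1 ≠ v.1) →
              (∀ u ∈ t, u.1 ≠ i) →
              (1 - 1 / (k : ℝ)) * ((n : ℝ) ^ (-(2 : ℝ) / (D : ℝ))) ^ a * n ≤
                  ((commonNbhd G t i).card : ℝ) ∧
                ((commonNbhd G t i).card : ℝ) ≤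
                  (1 + 1 / (k : ℝ)) * ((n : ℝ) ^ (-(2 : ℝ) / (D : ℝ))) ^ a * n) := by
  intro γ hγ
  have hlog : Filter.Tendsto (fun n : ℕ => Real.log (n : ℝ)) Filter.atTop Filter.atTop :=
    Real.tendsto_log_atTop.comp tendsto_natCast_atTop_atTop
  obtain ⟨n₀, hn₀⟩ := Filter.eventually_atTop.1
    (((asym.comp hlog).eventually (ge_mem_nhds hγ)).and (Filter.eventually_ge_atTop 2))
  refine ⟨n₀, fun n hn k D hD hk hDn => ?_⟩
  obtain ⟨hγn, hn2⟩ := hn₀ n hn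
  simp only [Function.comp] at hγn
  have hn2' : (2 : ℝ) ≤ n := by exact_mod_cast hn2
  have hn0 : (0 : ℝ) < n := by linarith
  have hn1 : (1 : ℝ) ≤ n := by linarith
  have hD0 : (0 : ℝ) < D := by exact_mod_cast hD
  set L := Real.log n with hL
  have hL0 : 0 ≤ L := Real.log_nonneg hn1
  set p : ℝ := (n : ℝ) ^ (-(2 : ℝ) / (D : ℝ)) with hp
  have hp0 : 0 ≤ p := Real.rpow_nonneg hn0.le _
  have hp1 : p ≤ 1 := Real.rpow_le_one_of_one_le_of_nonpos hn1
    (div_nonpos_of_nonpos_of_nonneg (by norm_num) hD0.le)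
  set B : ℝ := 2 * Real.exp (-(Real.exp (L / 10) / 4)) with hB
  have hB0 : 0 ≤ B := by positivity
  have hu := union_bd (k := k) (n := n) (m := D / 4) (p := p) (B := B) hp0 hp1
    (fun i t G => (1 - 1 / (k : ℝ)) * p ^ t.card * n ≤ ((commonNbhd G t i).card : ℝ) ∧
      ((commonNbhd G t i).card : ℝ) ≤ (1 + 1 / (k : ℝ)) * p ^ t.card * n)
    (fun i t => (t.card : ℝ) ≤ (D : ℝ) / 4 ∧ ∀ u ∈ t, u.1 ≠ i) hB0 ?_ ?_
  · have hkn : (k : ℝ) ≤ n := hk.trans (by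
      calc (n : ℝ) ^ ((1 : ℝ) / 5) ≤ (n : ℝ) ^ (1 : ℝ) :=
            Real.rpow_le_rpow_of_exponent_le hn1 (by norm_num)
        _ = n := Real.rpow_one _)
    have hm : ((D / 4 : ℕ) : ℝ) ≤ L := by
      have h1 : ((D / 4 : ℕ) : ℝ) ≤ (D : ℝ) / 4 := Nat.cast_div_le
      have h2 : Real.logb 2 n ≤ 2 * L := by
        rw [Real.logb, div_le_iff₀ (Real.log_pos (by norm_num))]
        nlinarith [Real.log_two_gt_d9]
      linarith
    have hnL : (n : ℝ) = Real.exp L := (Real.exp_log hn0).symm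
    have hcount : (k * (k * n + 1) ^ (D / 4) : ℝ) ≤ Real.exp (3 * L ^ 2 + L) := by
      have h3 : (k * n + 1 : ℝ) ≤ Real.exp (3 * L) := by
        have e3 : Real.exp (3 * L) = (n : ℝ) ^ 3 := by
          rw [hnL, ← Real.exp_nat_mul]; norm_num
        rw [e3]
        nlinarith [mul_le_mul_of_nonneg_right hkn hn0.le, mul_pos hn0 hn0]
      calc (k * (k * n + 1) ^ (D / 4) : ℝ) ≤ n * (Real.exp (3 * L)) ^ (D / 4) := by gcongr
        _ = Real.exp ((D / 4 : ℕ) * (3 * L) + L) := by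
            rw [← Real.exp_nat_mul, Real.exp_add, ← hnL, mul_comm]
        _ ≤ _ := by
            apply Real.exp_le_exp.2
            nlinarith
    have hfin : (k * (k * n + 1) ^ (D / 4) : ℝ) * B ≤ γ := by
      refine le_trans (mul_le_mul_of_nonneg_right hcount hB0) (le_trans (le_of_eq ?_) hγn)
      rw [hB, sub_eq_add_neg, Real.exp_add (3 * L ^ 2 + L)]
      ring
    refine le_trans (by linarith) (hu.trans ?_)
    classical
    unfold probG
    refine Finset.sum_le_sum fun G _ => ?_
    have hw := wtG_nonneg hp0 hp1 (potEdges k n) G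
    unfold wtG at hw
    split_ifs with ha hb hb
    · exact le_rfl
    · exfalso
      apply hb
      intro i a haD t hta _ hti
      subst hta
      exact ha i t ⟨haD, hti⟩
    · exact hw
    · exact le_rfl
  · rintro i t ⟨hta, hti⟩
    have hk1 : (1 : ℝ) ≤ k := by exact_mod_cast Fin.pos i
    have hk0 : (0 : ℝ) < k := by linarith
    have htl := tails (k := k) (n := n) (p := p) (δ := 1 / k) hp0 hp1 (by positivity)
      (by rw [div_le_one hk0]; exact hk1) t i hti
    refine le_trans (le_trans (le_of_eq ?_) htl) ?_
    · rw [probG]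
      refine Finset.sum_congr rfl fun G _ => ?_
      simp only [wtG]
      congr
    rw [hB]
    have hkey : Real.exp (L / 10) ≤ (1 / (k : ℝ)) ^ 2 * (p ^ t.card * n) := by
      have hnr : ∀ x : ℝ, (n : ℝ) ^ x = Real.exp (L * x) := fun x => Real.rpow_def_of_pos hn0 x
      have e1 : Real.exp (L / 2) ≤ p ^ t.card * n := by
        have : p ^ t.card * n = Real.exp (t.card * (L * (-2 / D)) + L) := by
          rw [hp, hnr, Real.exp_add, Real.exp_nat_mul, Real.exp_log hn0]
        rw [this]
        apply Real.exp_le_exp.2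
        have h5 : (t.card : ℝ) * (2 / D) ≤ 1 / 2 := by
          calc (t.card : ℝ) * (2 / D) ≤ (D / 4) * (2 / D) := by gcongr
            _ = 1 / 2 := by field_simp; norm_num
        have : (t.card : ℝ) * (L * (-2 / D)) = -(L * (t.card * (2 / D))) := by ring
        rw [this]
        nlinarith
      have e2 : (k : ℝ) ^ 2 ≤ Real.exp (2 * L / 5) := by
        calc (k : ℝ) ^ 2 ≤ (Real.exp (L * (1 / 5))) ^ 2 := by
              rw [← hnr]; gcongr
          _ = _ := by rw [← Real.exp_nat_mul]; congr 1; push_cast; ring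
      rw [div_pow, one_pow, one_div, inv_mul_eq_div, le_div_iff₀ (by positivity)]
      calc Real.exp (L / 10) * (k : ℝ) ^ 2 ≤ Real.exp (L / 10) * Real.exp (2 * L / 5) := by gcongr
        _ = Real.exp (L / 2) := by rw [← Real.exp_add]; congr 1; ring
        _ ≤ _ := e1
    have := Real.exp_le_exp.2 (show -((1 / (k : ℝ)) ^ 2 * (p ^ t.card * n) / 4) ≤
      -(Real.exp (L / 10) / 4) by linarith)
    linarith
  · rintro i t ⟨hta, -⟩
    rw [Nat.le_div_iff_mul_le (by norm_num)]
    rw [le_div_iff₀ (by norm_num)] at hta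
    exact_mod_cast hta
end
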